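/- The class NU of non-universal separable Banach spaces is strongly bounded: for every analytic subset A of NU there exists a non-universal separable Banach space Y ∈ NU such that every X ∈ A embeds isomorphically into Y. -/

import Mathlib

open Filter Topology MeasureTheory

noncomputable section

/-! ### The Cantor set and the space `C(2^ℕ)` -/

/-- The Cantor set `2^ℕ`. -/
abbrev CantorSet : Type := ℕ → Bool

/-- The Banach space `C(2^ℕ)` of continuous real-valued functions on the Cantor set. -/
abbrev CantorC : Type := C(CantorSet, ℝ)

/-! ### The standard Borel space `SB` of separable Banach spaces -/

/-- `SB`: the set of closed linear subspaces of `C(2^ℕ)`. -/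
def SB : Type := {Y : Submodule ℝ CantorC // IsClosed (Y : Set CantorC)}

/-- The Effros-Borel σ-algebra on `SB`, generated by the sets
`{Y : Y ∩ U ≠ ∅}` for `U` open in `C(2^ℕ)`. -/
instance : MeasurableSpace SB :=
  MeasurableSpace.generateFrom
    {A : Set SB | ∃ U : Set CantorC, IsOpen U ∧ A = {Y : SB | ((Y.1 : Set CantorC) ∩ U).Nonempty}}

/-- A subset of a standard Borel space is analytic if it is the image of a Borel map
from the Baire space `ℕ^ℕ`. -/
def IsAnalyticIn {α : Type*} [MeasurableSpace α] (A : Set α) : Prop :=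
  ∃ f : (ℕ → ℕ) → α, Measurable f ∧ A = Set.range f

/-! ### Embeddings, isomorphisms, universality -/

/-- `X` embeds isomorphically into `Y`: there is a bounded linear map which is
bounded below, i.e. an isomorphism onto its range. -/
def Embeds (X Y : Type*) [SeminormedAddCommGroup X] [NormedSpace ℝ X]
    [SeminormedAddCommGroup Y] [NormedSpace ℝ Y] : Prop :=
  ∃ (T : X →L[ℝ] Y) (c : ℝ), 0 < c ∧ ∀ x : X, c * ‖x‖ ≤ ‖T x‖

/-- `X` embeds isometrically into `Y` (i.e. `Y` contains an isometric copy of `X`). -/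
def EmbedsIsometrically (X Y : Type*) [SeminormedAddCommGroup X] [NormedSpace ℝ X]
    [SeminormedAddCommGroup Y] [NormedSpace ℝ Y] : Prop :=
  Nonempty (X →ₗᵢ[ℝ] Y)

/-- `X` and `Y` are isomorphic Banach spaces (linearly homeomorphic). -/
def IsomorphicTo (X Y : Type*) [SeminormedAddCommGroup X] [NormedSpace ℝ X]
    [SeminormedAddCommGroup Y] [NormedSpace ℝ Y] : Prop :=
  Nonempty (X ≃L[ℝ] Y)

/-- The class `NU ⊆ SB` of non-universal spaces: those `X ∈ SB` which do not contain
an isomorphic copy of `C(2^ℕ)` (equivalently, are not universal for all separable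
Banach spaces). -/
def NU : Set SB := {Y : SB | ¬ Embeds CantorC Y.1}

/-- The class `NC_X ⊆ SB` of all `Y ∈ SB` containing no isomorphic copy of `X`. -/
def NCin (X : Type*) [SeminormedAddCommGroup X] [NormedSpace ℝ X] : Set SB :=
  {Y : SB | ¬ Embeds X Y.1}

/-! ### Schauder bases -/

/-- `x` is a Schauder basis of `E`: every vector has a unique representation as a
norm convergent series `Σ aₙ • xₙ`. -/
def IsSchauderBasis {E : Type*} [SeminormedAddCommGroup E] [NormedSpace ℝ E]
    (x : ℕ → E) : Prop :=
  ∀ y : E, ∃! a : ℕ → ℝ,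
    Tendsto (fun m => ∑ n ∈ Finset.range m, a n • x n) atTop (𝓝 y)

/-- `E` has a Schauder basis. -/
def HasSchauderBasis (E : Type*) [SeminormedAddCommGroup E] [NormedSpace ℝ E] : Prop :=
  ∃ x : ℕ → E, IsSchauderBasis x

/-- `x` is a monotone basis sequence: initial-segment projections have norm at most 1. -/
def IsMonotoneSeq {E : Type*} [SeminormedAddCommGroup E] [NormedSpace ℝ E]
    (x : ℕ → E) : Prop :=
  ∀ (a : ℕ → ℝ) (k m : ℕ), k ≤ m →
    ‖∑ n ∈ Finset.range k, a n • x n‖ ≤ ‖∑ n ∈ Finset.range m, a n • x n‖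

/-- `x` is a bi-monotone sequence: interval projections have norm at most 1. -/
def IsBimonotoneSeq {E : Type*} [SeminormedAddCommGroup E] [NormedSpace ℝ E]
    (x : ℕ → E) : Prop :=
  ∀ (a : ℕ → ℝ) (j k m : ℕ), j ≤ k → k ≤ m →
    ‖∑ n ∈ Finset.Ico j k, a n • x n‖ ≤ ‖∑ n ∈ Finset.range m, a n • x n‖

/-- `x` is a Schauder basic sequence: it is a Schauder basis of its closed linear span. -/
def IsSchauderBasicSeq {E : Type*} [NormedAddCommGroup E] [NormedSpace ℝ E]
    (x : ℕ → E) : Prop :=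
  ∀ y ∈ (Submodule.span ℝ (Set.range x)).topologicalClosure,
    ∃! a : ℕ → ℝ,
      Tendsto (fun m => ∑ n ∈ Finset.range m, a n • x n) atTop (𝓝 y)

/-! ### Trees, ordinal ranks and Bourgain's index -/

/-- A tree on `Λ`: a set of finite sequences closed under initial segments. -/
def IsTree {Λ : Type*} (T : Set (List Λ)) : Prop :=
  ∀ s t : List Λ, s <+: t → t ∈ T → s ∈ T

/-- A pruned tree: every node has a proper extension in the tree. -/
def IsPruned {Λ : Type*} (T : Set (List Λ)) : Prop :=
  ∀ t ∈ T, ∃ a : Λ, t ++ [a] ∈ T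

/-- `σ` is an infinite branch of `T`. -/
def IsBranch {Λ : Type*} (T : Set (List Λ)) (σ : ℕ → Λ) : Prop :=
  ∀ n : ℕ, (List.ofFn fun i : Fin n => σ i) ∈ T

/-- `T` is ill-founded: it has an infinite branch. -/
def TreeIllFounded {Λ : Type*} (T : Set (List Λ)) : Prop :=
  ∃ σ : ℕ → Λ, IsBranch T σ

/-- The derivative of a tree: its non-maximal nodes, i.e. nodes having a proper
extension in the tree. -/
def treeDeriv {Λ : Type*} (T : Set (List Λ)) : Set (List Λ) :=
  {l | l ∈ T ∧ ∃ a : Λ, l ++ [a] ∈ T}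

/-- The iterated derivatives `T^(ξ)` of a tree, defined by transfinite recursion. -/
def treeDerivIter {Λ : Type*} (T : Set (List Λ)) (ξ : Ordinal.{0}) : Set (List Λ) :=
  Ordinal.limitRecOn ξ T (fun _ S => treeDeriv S)
    (fun o _ ih => ⋂ (o' : Ordinal.{0}) (h : o' < o), ih o' h)

/-- The ordinal rank `o(T)` of a (well-founded) tree: the least `ξ` with `T^(ξ) = ∅`. -/
def treeRank {Λ : Type*} (T : Set (List Λ)) : Ordinal.{0} :=
  sInf {ξ : Ordinal.{0} | treeDerivIter T ξ = ∅}

/-- The first uncountable ordinal `ω₁`. -/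
def omega1 : Ordinal.{0} := (Cardinal.aleph 1).ord

/-- Bourgain's tree `T(Y, (e_n), δ)`: all finite sequences `(y_0, …, y_k)` in `Y`
which are `δ`-equivalent to `(e_0, …, e_k)`. -/
def bourgainTree {W : Type*} [SeminormedAddCommGroup W] [NormedSpace ℝ W] (e : ℕ → W)
    (δ : ℝ) (Y : Type*) [SeminormedAddCommGroup Y] [NormedSpace ℝ Y] : Set (List Y) :=
  {l : List Y | ∀ a : ℕ → ℝ,
    δ * ‖∑ i ∈ Finset.range l.length, a i • e i‖ ≤
        ‖∑ i ∈ Finset.range l.length, a i • l.getD i 0‖ ∧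
    ‖∑ i ∈ Finset.range l.length, a i • l.getD i 0‖ ≤
        δ⁻¹ * ‖∑ i ∈ Finset.range l.length, a i • e i‖}

open Classical in
/-- Bourgain's ordinal index of `Y` relative to a (normalized Schauder) basis `(e_n)`
of a space `W`: it equals `ω₁` if some tree `T(Y, (e_n), δ)` is ill-founded, and
otherwise `sup_{0 < δ ≤ 1} o(T(Y, (e_n), δ))`.  With `W = C(2^ℕ)` this is `φ_NU`,
and with `W = Z` it is `φ_{NC_Z}`. -/
def bourgainIndex {W : Type*} [SeminormedAddCommGroup W] [NormedSpace ℝ W] (e : ℕ → W)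
    (Y : Type*) [SeminormedAddCommGroup Y] [NormedSpace ℝ Y] : Ordinal.{0} :=
  if ∃ δ ∈ Set.Ioc (0:ℝ) 1, TreeIllFounded (bourgainTree e δ Y) then omega1
  else ⨆ δ : Set.Ioc (0:ℝ) 1, treeRank (bourgainTree e δ.1 Y)

/-! ### The Schur property and the Radon-Nikodym property -/

/-- `X` has the Schur property: weakly convergent sequences are norm convergent. -/
def HasSchurProperty (X : Type*) [SeminormedAddCommGroup X] [NormedSpace ℝ X] : Prop :=
  ∀ (f : ℕ → X) (x : X),
    (∀ φ : X →L[ℝ] ℝ, Tendsto (fun n => φ (f n)) atTop (𝓝 (φ x))) →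
    Tendsto f atTop (𝓝 x)

/-- `X` has the Radon-Nikodym property: on every finite measure space, every
`X`-valued vector measure of bounded variation which is absolutely continuous
with respect to the measure has a Bochner-integrable density. -/
def HasRNP (X : Type*) [NormedAddCommGroup X] [NormedSpace ℝ X] : Prop :=
  ∀ (Ω : Type) [MeasurableSpace Ω] (μ : Measure Ω), IsFiniteMeasure μ →
    ∀ τ : VectorMeasure Ω X,
      (∀ s : Set Ω, MeasurableSet s → μ s = 0 → τ s = 0) →
      (∃ C : ℝ, ∀ P : Finset (Set Ω), (∀ s ∈ P, MeasurableSet s) →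
        ((P : Set (Set Ω)).Pairwise fun s t => Disjoint s t) →
        ∑ s ∈ P, ‖τ s‖ ≤ C) →
      ∃ g : Ω → X, Integrable g μ ∧
        ∀ s : Set Ω, MeasurableSet s → τ s = ∫ x in s, g x ∂μ

/-! ### `𝓛_{∞,λ}`-spaces -/

/-- The Banach-Mazur distance from `G` to `ℓ∞^n` is at most `θ`, witnessed by an
isomorphism `e` with `‖e‖ ⬝ ‖e⁻¹‖ ≤ θ'` for every `θ' > θ`. -/
def BMdistToLinftyLE (G : Type*) [SeminormedAddCommGroup G] [NormedSpace ℝ G]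
    (n : ℕ) (θ : ℝ) : Prop :=
  ∀ θ' : ℝ, θ < θ' → ∃ e : G ≃L[ℝ] (Fin n → ℝ),
    ‖(e : G →L[ℝ] (Fin n → ℝ))‖ * ‖(e.symm : (Fin n → ℝ) →L[ℝ] G)‖ ≤ θ'

/-- `X` is an (infinite-dimensional) `𝓛_{∞,λ}`-space: every finite-dimensional subspace
`F` of `X` is contained in a finite-dimensional subspace `G` with `d(G, ℓ∞^(dim G)) ≤ λ`. -/
def IsLinftyLam (lam : ℝ) (X : Type*) [NormedAddCommGroup X] [NormedSpace ℝ X] : Prop :=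
  (¬ FiniteDimensional ℝ X) ∧
  ∀ F : Submodule ℝ X, FiniteDimensional ℝ F →
    ∃ G : Submodule ℝ X, F ≤ G ∧ FiniteDimensional ℝ G ∧
      BMdistToLinftyLE G (Module.finrank ℝ G) lam

/-- `X` is an `𝓛_{∞,λ+}`-space: it is an `𝓛_{∞,θ}`-space for every `θ > λ`. -/
def IsLinftyPlus (lam : ℝ) (X : Type*) [NormedAddCommGroup X] [NormedSpace ℝ X] : Prop :=
  ∀ θ : ℝ, lam < θ → IsLinftyLam θ X

/-! ### Minimal spaces and `ℓ₁` -/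

/-- The space `ℓ₁`. -/
abbrev EllOne : Type := lp (fun _ : ℕ => ℝ) 1

/-- `X` is a minimal Banach space: it is infinite-dimensional and embeds isomorphically
into every infinite-dimensional (closed) subspace of itself. -/
def IsMinimal (X : Type*) [NormedAddCommGroup X] [NormedSpace ℝ X] : Prop :=
  (¬ FiniteDimensional ℝ X) ∧
  ∀ Z : Submodule ℝ X, IsClosed (Z : Set X) → ¬ FiniteDimensional ℝ Z → Embeds X Z

end



namespace NUB
noncomputable section

/-- `f` depends only on the first `m` coordinates. -/
def IsLev (m : ℕ) (f : CantorSet → ℝ) : Prop :=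
  ∀ x y : CantorSet, (∀ i < m, x i = y i) → f x = f y

lemma IsLev.mono {m n : ℕ} {f : CantorSet → ℝ} (h : IsLev m f) (hmn : m ≤ n) : IsLev n f :=
  fun x y hxy => h x y fun i hi => hxy i (hi.trans_le hmn)

/-- Step functions on the Cantor set. -/
def Dy : Submodule ℝ (CantorSet → ℝ) where
  carrier := {f | ∃ m, IsLev m f}
  add_mem' := by
    rintro f g ⟨m, hm⟩ ⟨n, hn⟩
    refine ⟨max m n, fun x y h => ?_⟩
    simp only [Pi.add_apply]
    rw [(hm.mono (le_max_left m n)) x y h, (hn.mono (le_max_right m n)) x y h]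
  zero_mem' := ⟨0, fun _ _ _ => rfl⟩
  smul_mem' := by
    rintro c f ⟨m, hm⟩
    refine ⟨m, fun x y h => ?_⟩
    simp only [Pi.smul_apply]
    rw [hm x y h]

def Bd (f : Dy) (c : ℝ) : Prop := ∀ z, |f.1 z| ≤ c

lemma Bd.mono {f : Dy} {c d : ℝ} (h : Bd f c) (hcd : c ≤ d) : Bd f d := fun z => (h z).trans hcd

lemma Bd.nonneg {f : Dy} {c : ℝ} (h : Bd f c) : 0 ≤ c := (abs_nonneg _).trans (h fun _ => false)

@[simp] lemma Dy.add_apply (f g : Dy) (z : CantorSet) : (f + g).1 z = f.1 z + g.1 z := rfl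
@[simp] lemma Dy.sub_apply (f g : Dy) (z : CantorSet) : (f - g).1 z = f.1 z - g.1 z := rfl
@[simp] lemma Dy.neg_apply (f : Dy) (z : CantorSet) : (-f).1 z = -f.1 z := rfl
@[simp] lemma Dy.smul_apply (a : ℝ) (f : Dy) (z : CantorSet) : (a • f).1 z = a * f.1 z := rfl
@[simp] lemma Dy.zero_apply (z : CantorSet) : (0 : Dy).1 z = 0 := rfl
lemma Dy.sum_apply {ι : Type*} (s : Finset ι) (f : ι → Dy) (z : CantorSet) :
    (∑ i ∈ s, f i).1 z = ∑ i ∈ s, (f i).1 z := by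
  classical
  induction s using Finset.induction_on with
  | empty => simp
  | insert a s ha ih => rw [Finset.sum_insert ha, Finset.sum_insert ha, Dy.add_apply, ih]

lemma exists_max (f : Dy) : ∃ z, Bd f |f.1 z| := by
  obtain ⟨m, hm⟩ := f.2
  let ext : (Fin m → Bool) → CantorSet := fun u i => if h : i < m then u ⟨i, h⟩ else false
  obtain ⟨u, -, hu⟩ := Finset.exists_max_image (Finset.univ : Finset (Fin m → Bool))
    (fun u => |f.1 (ext u)|) Finset.univ_nonempty
  refine ⟨ext u, fun z => ?_⟩
  have : f.1 z = f.1 (ext fun i => z i) := hm _ _ fun i hi => by simp [ext, hi]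
  rw [this]
  exact hu (fun i => z i) (Finset.mem_univ _)

structure Cyl where
  pt : CantorSet
  len : ℕ

def Cyl.mem (c : Cyl) (x : CantorSet) : Prop := ∀ i < c.len, x i = c.pt i

lemma Cyl.mem_pt (c : Cyl) : c.mem c.pt := fun _ _ => rfl

def Cyl.le (c d : Cyl) : Prop := ∀ x, c.mem x → d.mem x

lemma Cyl.le_refl (c : Cyl) : c.le c := fun _ h => h
lemma Cyl.le_trans {a b c : Cyl} (h : a.le b) (h' : b.le c) : a.le c := fun x hx => h' x (h x hx)

def Cyl.top : Cyl := ⟨fun _ => false, 0⟩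
lemma Cyl.mem_top (x : CantorSet) : Cyl.top.mem x := fun i hi => absurd hi (Nat.not_lt_zero i)

/-- the `i`-th of a sequence of disjoint subcylinders -/
def Cyl.sub (c : Cyl) (i : ℕ) : Cyl :=
  ⟨fun n => if n < c.len then c.pt n else decide (n < c.len + i), c.len + i + 1⟩

lemma Cyl.sub_le (c : Cyl) (i : ℕ) : (c.sub i).le c := by
  intro x hx n hn
  have := hx n (by simp only [Cyl.sub]; omega)
  rw [this]
  simp [Cyl.sub, hn]

lemma Cyl.sub_disj (c : Cyl) {i j : ℕ} (hij : i ≠ j) {x : CantorSet} (hx : (c.sub i).mem x) :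
    ¬ (c.sub j).mem x := by
  intro hy
  wlog h : i < j generalizing i j
  · exact this hij.symm hy hx (by omega)
  have h1 := hx (c.len + i) (by simp only [Cyl.sub]; omega)
  have h2 := hy (c.len + i) (by simp only [Cyl.sub]; omega)
  simp [Cyl.sub] at h1 h2
  rw [h1] at h2
  simp at h2
  omega

def Supp (c : Cyl) (f : Dy) : Prop := ∀ x, ¬ c.mem x → f.1 x = 0

lemma Supp.mono {c d : Cyl} {f : Dy} (h : Supp c f) (hcd : c.le d) : Supp d f :=
  fun x hx => h x fun h' => hx (hcd x h')

structure IsH (c : Cyl) (h : Dy) : Prop where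
  supp : Supp c h
  bd : Bd h 1
  one : ∃ x, h.1 x = 1

lemma IsH.mono {c d : Cyl} {f : Dy} (h : IsH c f) (hcd : c.le d) : IsH d f :=
  ⟨h.supp.mono hcd, h.bd, h.one⟩

/-- normalisation -/
lemma exists_normalize {c : Cyl} {f : Dy} (hf : Supp c f) {z : CantorSet} (r : ℝ) (hr : 0 < r)
    (hz : r ≤ |f.1 z|) : ∃ b : ℝ, |b| ≤ 1 / r ∧ IsH c (b • f) := by
  obtain ⟨w, hw⟩ := exists_max f
  have hw0 : r ≤ |f.1 w| := hz.trans (hw z)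
  have hne : f.1 w ≠ 0 := by
    intro h; rw [h, abs_zero] at hw0; linarith
  refine ⟨(f.1 w)⁻¹, ?_, ?_, ?_, w, ?_⟩
  · rw [abs_inv, one_div]; exact inv_anti₀ hr hw0
  · intro x hx; simp [hf x hx]
  · intro x
    rw [Dy.smul_apply, abs_mul, abs_inv]
    have : 0 < |f.1 w| := abs_pos.2 hne
    rw [inv_mul_le_iff₀ this]
    simpa using hw x
  · simp [hne]

lemma exists_one_cyl {c : Cyl} {h : Dy} (hh : IsH c h) :
    ∃ d : Cyl, d.le c ∧ ∀ x, d.mem x → h.1 x = 1 := by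
  obtain ⟨m, hm⟩ := h.2
  obtain ⟨x, hx⟩ := hh.one
  have hxc : c.mem x := by
    by_contra hn
    have := hh.supp x hn
    rw [hx] at this; exact one_ne_zero this
  refine ⟨⟨x, max m c.len⟩, fun y hy i hi => ?_, fun y hy => ?_⟩
  · exact (hy i (lt_of_lt_of_le hi (le_max_right _ _))).trans (hxc i hi)
  · rw [← hx]
    exact hm _ _ fun i hi => hy i (lt_of_lt_of_le hi (le_max_left _ _))

def oneCyl (c : Cyl) (h : Dy) : Cyl :=
  open Classical in if hh : IsH c h then (exists_one_cyl hh).choose else c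

lemma oneCyl_le {c : Cyl} {h : Dy} (hh : IsH c h) : (oneCyl c h).le c := by
  rw [oneCyl, dif_pos hh]; exact (exists_one_cyl hh).choose_spec.1

lemma oneCyl_one {c : Cyl} {h : Dy} (hh : IsH c h) {x} (hx : (oneCyl c h).mem x) : h.1 x = 1 := by
  rw [oneCyl, dif_pos hh] at hx; exact (exists_one_cyl hh).choose_spec.2 x hx

/-! ### The sequence trick -/

lemma seq_trick {σ W : Type*} (R : σ → Dy → W → σ → Prop) (c0 : Cyl) (s0 : σ)
    (step : ∀ c : Cyl, c.le c0 → ∀ s, ∃ h w s', IsH c h ∧ R s h w s') :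
    ∃ (h : ℕ → Dy) (w : ℕ → W) (s : ℕ → σ), s 0 = s0 ∧ (∀ j, R (s j) (h j) (w j) (s (j + 1))) ∧
      (∀ j, IsH c0 (h j)) ∧
      (∀ N : ℕ, ∃ z, (∑ j ∈ Finset.range N, h j).1 z = N) ∧
      (∀ N : ℕ, Bd (∑ j ∈ Finset.range N, (-1 : ℝ) ^ j • h j) 2) := by
  haveI : Nonempty W := ⟨(step c0 (Cyl.le_refl _) s0).choose_spec.choose⟩
  haveI : Nonempty σ := ⟨s0⟩
  choose! fh fw fs hH hR using step
  let st : ℕ → Cyl × σ := fun n => Nat.rec (c0, s0)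
    (fun _ p => (oneCyl p.1 (fh p.1 p.2), fs p.1 p.2)) n
  have st0 : st 0 = (c0, s0) := rfl
  have stS : ∀ n, st (n + 1) = (oneCyl (st n).1 (fh (st n).1 (st n).2), fs (st n).1 (st n).2) :=
    fun n => rfl
  have hle : ∀ n, (st n).1.le c0 := by
    intro n
    induction n with
    | zero => exact Cyl.le_refl _
    | succ n ih =>
      rw [stS]
      exact Cyl.le_trans (oneCyl_le (hH _ ih _)) ih
  have hIs : ∀ n, IsH (st n).1 (fh (st n).1 (st n).2) := fun n => hH _ (hle n) _
  have hstep : ∀ n, (st (n+1)).1.le (st n).1 := fun n => by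
    rw [stS]; exact oneCyl_le (hIs n)
  have hone : ∀ n x, (st (n+1)).1.mem x → (fh (st n).1 (st n).2).1 x = 1 := fun n x hx => by
    rw [stS] at hx; exact oneCyl_one (hIs n) hx
  have hanti : ∀ m n, m ≤ n → (st n).1.le (st m).1 := by
    intro m n hmn
    induction n, hmn using Nat.le_induction with
    | base => exact Cyl.le_refl _
    | succ n _ ih => exact Cyl.le_trans (hstep n) ih
  refine ⟨fun n => fh (st n).1 (st n).2, fun n => fw (st n).1 (st n).2, fun n => (st n).2, rfl,
    fun j => ?_, fun j => (hIs j).mono (hle j), fun N => ?_, fun N => ?_⟩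
  · have := hR (st j).1 (hle j) (st j).2
    exact this
  · refine ⟨(st N).1.pt, ?_⟩
    rw [Dy.sum_apply, Finset.sum_congr rfl (g := fun _ => (1:ℝ))]
    · simp
    · intro j hj
      exact hone j _ (hanti (j+1) N (Finset.mem_range.1 hj) _ (Cyl.mem_pt _))
  · -- stronger induction
    intro z
    rw [Dy.sum_apply]
    simp only [Dy.smul_apply]
    have key : ∀ N : ℕ, ((st N).1.mem z → ∑ j ∈ Finset.range N, (-1 : ℝ) ^ j *
        (fh (st j).1 (st j).2).1 z = if Even N then 0 else 1) ∧
        |∑ j ∈ Finset.range N, (-1 : ℝ) ^ j * (fh (st j).1 (st j).2).1 z| ≤ 2 := by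
      intro N
      induction N with
      | zero => simp
      | succ N ih =>
        constructor
        · intro hz
          rw [Finset.sum_range_succ, ih.1 (hstep N z hz), hone N z hz]
          rcases Nat.even_or_odd N with h | h
          · have h' : ¬ Even (N + 1) := by simpa [Nat.even_add_one] using h
            rw [if_pos h, if_neg h', h.neg_one_pow]; norm_num
          · have h' : Even (N + 1) := h.add_one
            have h'' : ¬ Even N := by simpa using h
            rw [if_neg h'', if_pos h', h.neg_one_pow]; norm_num
        · rw [Finset.sum_range_succ]
          by_cases hz : (st N).1.mem z
          · rw [ih.1 hz]
            have hb := (hIs N).bd z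
            have e1 : |(-1 : ℝ) ^ N * (fh (st N).1 (st N).2).1 z| ≤ 1 := by
              rw [abs_mul, abs_neg_one_pow, one_mul]; exact hb
            refine (abs_add_le _ _).trans ?_
            have : |(if Even N then (0:ℝ) else 1)| ≤ 1 := by split_ifs <;> norm_num
            linarith
          · rw [(hIs N).supp z hz, mul_zero, add_zero]; exact ih.2
    exact (key N).2

/-! ### The copy lemma -/

def pt (t : List Bool) : CantorSet := fun i => t.reverse.getD i false

lemma pt_cons_lt (b : Bool) (t : List Bool) {i : ℕ} (hi : i < t.length) :
    pt (b :: t) i = pt t i := by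
  simp [pt, List.getD, List.getElem?_append, hi]

lemma pt_cons_len (b : Bool) (t : List Bool) : pt (b :: t) t.length = b := by
  simp [pt, List.getD]

lemma pt_false (t : List Bool) : pt (false :: t) = pt t := by
  funext i
  rcases lt_trichotomy i t.length with h | h | h
  · exact pt_cons_lt _ _ h
  · subst h; rw [pt_cons_len]; simp [pt, List.getD]
  · have h1 : (false :: t).reverse.length ≤ i := by simp; omega
    have h2 : t.reverse.length ≤ i := by simp; omega
    simp only [pt]
    rw [List.getD_eq_default _ _ h1, List.getD_eq_default _ _ h2]

def evalD (z : CantorSet) : Dy →ₗ[ℝ] ℝ where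
  toFun f := f.1 z
  map_add' _ _ := rfl
  map_smul' _ _ := rfl

def cf (t : List Bool) : Dy →ₗ[ℝ] ℝ := evalD (pt (true :: t)) - evalD (pt t)

lemma cf_apply (t : List Bool) (f : Dy) : cf t f = f.1 (pt (true :: t)) - f.1 (pt t) := rfl

section copy
variable {W : Type*} [AddCommGroup W] [Module ℝ W] (g : List Bool → W)

def Kop : ℕ → List Bool → Dy →ₗ[ℝ] W
  | 0, _ => 0
  | n + 1, t => (cf t).smulRight (g t) + Kop n (true :: t) + Kop n (false :: t)

lemma Kop_zero (t f) : Kop g 0 t f = 0 := rfl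
lemma Kop_succ (n t f) :
    Kop g (n+1) t f = cf t f • g t + Kop g n (true :: t) f + Kop g n (false :: t) f := rfl

lemma Kop_compat (n : ℕ) : ∀ (t : List Bool) (f : Dy), IsLev (t.length + n) f.1 →
    Kop g (n+1) t f = Kop g n t f := by
  induction n with
  | zero =>
    intro t f hf
    rw [Kop_succ, Kop_zero, Kop_zero, Kop_zero, cf_apply,
      hf (pt (true :: t)) (pt t) fun i hi => pt_cons_lt _ _ (by simpa using hi)]
    simp
  | succ n ih =>
    intro t f hf
    rw [Kop_succ g (n+1) t, Kop_succ g n t]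
    rw [ih (true :: t) f (by simpa [add_assoc, add_comm, add_left_comm] using hf),
      ih (false :: t) f (by simpa [add_assoc, add_comm, add_left_comm] using hf)]

end copy

lemma union_linear {W : Type*} [AddCommGroup W] [Module ℝ W] (L : ℕ → Dy →ₗ[ℝ] W)
    (hL : ∀ m (f : Dy), IsLev m f.1 → L (m+1) f = L m f) :
    ∃ J : Dy →ₗ[ℝ] W, ∀ m (f : Dy), IsLev m f.1 → J f = L m f := by
  have h1 : ∀ (f : Dy) m n, m ≤ n → IsLev m f.1 → L n f = L m f := by
    intro f m n hmn hf
    induction n, hmn using Nat.le_induction with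
    | base => rfl
    | succ n hn ih => rw [hL n f (hf.mono hn), ih]
  have hJ : ∀ m (f : Dy), IsLev m f.1 → L f.2.choose f = L m f := by
    intro m f hf
    rw [← h1 f _ _ (le_max_left m f.2.choose) hf, h1 f _ _ (le_max_right m f.2.choose)
      f.2.choose_spec]
  refine ⟨{ toFun := fun f => L f.2.choose f, map_add' := ?_, map_smul' := ?_ }, hJ⟩
  · intro f g
    obtain ⟨m, hm⟩ := f.2
    obtain ⟨n, hn⟩ := g.2
    have hm' := hm.mono (le_max_left m n)
    have hn' := hn.mono (le_max_right m n)
    rw [hJ _ f hm', hJ _ g hn', hJ (max m n) (f + g), map_add]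
    intro x y h
    simp [hm' x y h, hn' x y h]
  · intro a f
    obtain ⟨m, hm⟩ := f.2
    rw [hJ _ f hm, hJ m (a • f), map_smul, RingHom.id_apply]
    intro x y h
    simp [hm x y h]

/-- The copy lemma. -/
theorem copy_lemma {X E : Type*} [AddCommGroup X] [Module ℝ X]
    (N : E → (Dy × X →ₗ[ℝ] ℝ))
    (hN : ∀ (c : Cyl) (ε : ℝ), 0 < ε → ∃ h x, IsH c h ∧ ∀ e, |N e (h, x)| ≤ ε)
    (c : Cyl) (ε : ℝ) (hε : 0 < ε) :
    ∃ (j : Dy →ₗ[ℝ] Dy) (S : Dy →ₗ[ℝ] X), (∀ f, Supp c (j f)) ∧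
      (∀ f r, Bd f r → Bd (j f) (3 * r)) ∧ (∀ f x, ∃ z, (j f).1 z = f.1 x) ∧
      ∀ f r, Bd f r → ∀ e, |N e (j f, S f)| ≤ ε * r := by
  choose! G1 G2 GH GN using hN
  let η : ℕ → ℝ := fun n => ε / 8 * (1/4) ^ n
  have hη : ∀ n, 0 < η n := fun n => by positivity
  let hs : Dy := G1 c (η 0)
  let xs : X := G2 c (η 0)
  let V : List Bool → Cyl := fun t => List.rec (oneCyl c hs)
    (fun b t d => bif b then oneCyl (d.sub 0) (G1 (d.sub 0) (η t.length)) else d.sub 1) t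
  have V0 : V [] = oneCyl c hs := rfl
  have V1 : ∀ t, V (true :: t) = oneCyl ((V t).sub 0) (G1 ((V t).sub 0) (η t.length)) :=
    fun t => rfl
  have V2 : ∀ t, V (false :: t) = (V t).sub 1 := fun t => rfl
  let g : List Bool → Dy × X := fun t =>
    (G1 ((V t).sub 0) (η t.length), G2 ((V t).sub 0) (η t.length))
  have gH : ∀ t, IsH ((V t).sub 0) (g t).1 := fun t => GH _ _ (hη _)
  have gN : ∀ t e, |N e (g t)| ≤ η t.length := fun t e => GN _ _ (hη _) e
  have hsH : IsH c hs := GH _ _ (hη _)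
  -- V facts
  have V1le : ∀ t, (V (true :: t)).le ((V t).sub 0) := fun t => by
    rw [V1]; exact oneCyl_le (gH t)
  have V1one : ∀ t z, (V (true :: t)).mem z → (g t).1.1 z = 1 := fun t z hz => by
    rw [V1] at hz; exact oneCyl_one (gH t) hz
  have Vle : ∀ b t, (V (b :: t)).le (V t) := by
    intro b t
    cases b
    · rw [V2]; exact Cyl.sub_le _ _
    · exact Cyl.le_trans (V1le t) (Cyl.sub_le _ _)
  have Kfst : ∀ n t f z, (Kop g (n+1) t f).1.1 z = cf t f * (g t).1.1 z +
      (Kop g n (true :: t) f).1.1 z + (Kop g n (false :: t) f).1.1 z := by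
    intro n t f z; rw [Kop_succ]; simp
  have Ksupp : ∀ n t f z, ¬ (V t).mem z → (Kop g n t f).1.1 z = 0 := by
    intro n
    induction n with
    | zero => intro t f z _; simp [Kop_zero]
    | succ n ih =>
      intro t f z hz
      rw [Kfst, ih _ f z (fun h => hz (Vle _ _ _ h)), ih _ f z (fun h => hz (Vle _ _ _ h)),
        (gH t).supp z (fun h => hz (Cyl.sub_le _ _ _ h))]
      simp
  have Kcase1 : ∀ n t f z, (V (true :: t)).mem z → f.1 (pt t) + (Kop g (n+1) t f).1.1 z =
      f.1 (pt (true :: t)) + (Kop g n (true :: t) f).1.1 z := by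
    intro n t f z hz
    have hz0 : ¬ (V (false :: t)).mem z := by
      rw [V2]; exact Cyl.sub_disj _ (by norm_num) (V1le t z hz)
    rw [Kfst, V1one t z hz, Ksupp _ (false :: t) _ _ hz0, cf_apply]; ring
  have Kcase0 : ∀ n t f z, (V (false :: t)).mem z → f.1 (pt t) + (Kop g (n+1) t f).1.1 z =
      f.1 (pt (false :: t)) + (Kop g n (false :: t) f).1.1 z := by
    intro n t f z hz
    have hz0 : ¬ ((V t).sub 0).mem z := by
      rw [V2] at hz; exact Cyl.sub_disj _ (by norm_num) hz
    have hz1 : ¬ (V (true :: t)).mem z := fun h => hz0 (V1le _ _ h)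
    rw [Kfst, (gH t).supp z hz0, Ksupp _ _ _ _ hz1, pt_false]; ring
  have Kup : ∀ n t f r z, Bd f r → (V t).mem z → |f.1 (pt t) + (Kop g n t f).1.1 z| ≤ 3 * r := by
    intro n
    induction n with
    | zero =>
      intro t f r z hf _
      have := hf (pt t); have := hf.nonneg
      simp [Kop_zero]; linarith
    | succ n ih =>
      intro t f r z hf hz
      by_cases h1 : (V (true :: t)).mem z
      · rw [Kcase1 _ _ _ _ h1]; exact ih _ _ _ _ hf h1
      by_cases h0 : (V (false :: t)).mem z
      · rw [Kcase0 _ _ _ _ h0]; exact ih _ _ _ _ hf h0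
      rw [Kfst, Ksupp _ _ _ _ h1, Ksupp _ _ _ _ h0, add_zero, add_zero]
      have a1 := hf (pt t)
      have a2 := hf (pt (true :: t))
      have a3 := (gH t).bd z
      have a4 : |cf t f| ≤ 2 * r := by
        rw [cf_apply]; exact (abs_sub _ _).trans (by linarith)
      have a5 : |cf t f * (g t).1.1 z| ≤ 2 * r := by
        rw [abs_mul]
        have := mul_le_mul a4 a3 (abs_nonneg _) ((abs_nonneg _).trans a4)
        linarith
      exact (abs_add_le _ _).trans (by linarith)
  have Klow : ∀ n t (f : Dy) x, IsLev (t.length + n) f.1 → (∀ i < t.length, x i = pt t i) →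
      ∃ z, (V t).mem z ∧ f.1 (pt t) + (Kop g n t f).1.1 z = f.1 x := by
    intro n
    induction n with
    | zero =>
      intro t f x hf hx
      refine ⟨(V t).pt, Cyl.mem_pt _, ?_⟩
      simp only [Kop_zero, Prod.fst_zero, Dy.zero_apply, add_zero]
      exact hf _ _ fun i hi => (hx i (by simpa using hi)).symm
    | succ n ih =>
      intro t f x hf hx
      have hb : ∀ i < (x t.length :: t).length, x i = pt (x t.length :: t) i := by
        intro i hi
        rcases (Nat.lt_succ_iff_lt_or_eq.1 (by simpa using hi)) with h | h
        · rw [pt_cons_lt _ _ h, hx i h]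
        · subst h; rw [pt_cons_len]
      obtain ⟨z, hz, hz'⟩ := ih (x t.length :: t) f x
        (by simpa [add_assoc, add_comm, add_left_comm] using hf) hb
      refine ⟨z, Vle _ _ _ hz, ?_⟩
      rw [← hz']
      generalize x t.length = b at hz
      cases b
      · exact Kcase0 _ _ _ _ hz
      · exact Kcase1 _ _ _ _ hz
  have KN : ∀ n t f r e, Bd f r → |N e (Kop g n t f)| ≤ 4 * r * η t.length := by
    intro n
    induction n with
    | zero =>
      intro t f r e hf
      have := hf.nonneg; have := (hη t.length).le
      rw [Kop_zero, map_zero, abs_zero]; positivity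
    | succ n ih =>
      intro t f r e hf
      rw [Kop_succ, map_add, map_add, map_smul, smul_eq_mul]
      have i1 := ih (true :: t) f r e hf
      have i2 := ih (false :: t) f r e hf
      have e1 : η (t.length + 1) = η t.length / 4 := by simp only [η, pow_succ]; ring
      rw [List.length_cons, e1] at i1 i2
      have a1 := hf (pt t)
      have a2 := hf (pt (true :: t))
      have a4 : |cf t f| ≤ 2 * r := by
        rw [cf_apply]; exact (abs_sub _ _).trans (by linarith)
      have a5 : |cf t f * N e (g t)| ≤ 2 * r * η t.length := by
        rw [abs_mul]
        exact mul_le_mul a4 (gN t e) (abs_nonneg _) ((abs_nonneg _).trans a4)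
      refine (abs_add_le _ _).trans ?_
      have := abs_add_le (cf t f * N e (g t)) (N e (Kop g n (true :: t) f))
      linarith
  -- assemble
  obtain ⟨J, hJ⟩ := union_linear
    (fun m => (evalD (fun _ => false)).smulRight ((hs, xs) : Dy × X) + Kop g m [])
    (by
      intro m f hf
      simp only [LinearMap.add_apply]
      rw [Kop_compat g m [] f (by simpa using hf)])
  have hJ' : ∀ m (f : Dy), IsLev m f.1 → J f = f.1 (fun _ => false) • ((hs, xs) : Dy × X)
      + Kop g m [] f := fun m f hf => by rw [hJ m f hf]; rfl
  have pt0 : pt [] = fun _ => false := by funext i; simp [pt]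
  have hJ1 : ∀ m (f : Dy), IsLev m f.1 → ∀ z, (J f).1.1 z =
      f.1 (pt []) * hs.1 z + (Kop g m [] f).1.1 z := fun m f hf z => by
    rw [hJ' m f hf, pt0]; simp
  refine ⟨(LinearMap.fst ℝ Dy X).comp J, (LinearMap.snd ℝ Dy X).comp J, ?_, ?_, ?_, ?_⟩
  · intro f z hz
    obtain ⟨m, hm⟩ := f.2
    change (J f).1.1 z = 0
    rw [hJ1 m f hm, hsH.supp z hz, Ksupp _ _ _ _ (fun h => hz (oneCyl_le hsH _ h))]
    simp
  · intro f r hf z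
    obtain ⟨m, hm⟩ := f.2
    change |(J f).1.1 z| ≤ _
    rw [hJ1 m f hm]
    by_cases hz : (V []).mem z
    · have := oneCyl_one hsH hz
      rw [this, mul_one]
      exact Kup m [] f r z hf hz
    · rw [Ksupp _ _ _ _ hz, add_zero, abs_mul]
      have h1 := hsH.bd z
      have h2 := hf (pt [])
      have := mul_le_mul h2 h1 (abs_nonneg _) hf.nonneg
      have := hf.nonneg
      linarith
  · intro f x
    obtain ⟨m, hm⟩ := f.2
    obtain ⟨z, hz, hz'⟩ := Klow m [] f x (by simpa using hm) (by simp)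
    refine ⟨z, ?_⟩
    change (J f).1.1 z = _
    rw [hJ1 m f hm, oneCyl_one hsH hz, mul_one, hz']
  · intro f r hf e
    obtain ⟨m, hm⟩ := f.2
    change |N e (J f)| ≤ _
    rw [hJ' m f hm, map_add, map_smul, smul_eq_mul]
    have h1 := KN m [] f r e hf
    have h2 := GN c (η 0) (hη 0) e
    have h3 := hf (fun _ => false)
    have e0 : η 0 = ε / 8 := by simp [η]
    have h4 : |f.1 (fun _ => false) * N e (hs, xs)| ≤ r * η 0 := by
      rw [abs_mul]; exact mul_le_mul h3 h2 (abs_nonneg _) hf.nonneg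
    rw [List.length_nil, e0] at h1
    rw [e0] at h4
    have := mul_nonneg hf.nonneg hε.le
    exact (abs_add_le _ _).trans (by linarith)

end
end NUB


namespace NUB
noncomputable section

structure Dat where
  A : Type
  cnt : Countable A
  D : A → CantorC
  lv : A → ℕ
  hlv : ∀ a, IsLev (lv a) (D a)
  B : Set (ℕ → A)
  closed : ∀ γ : ℕ → A, (∀ n, ∃ β ∈ B, ∀ i < n, β i = γ i) → γ ∈ B
  nonuniv : ∀ β ∈ B, ¬ Embeds CantorC
    (Submodule.span ℝ (Set.range fun i => D (β i))).topologicalClosure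

variable {Δ : Dat}

abbrev res {A : Type} (β : ℕ → A) (n : ℕ) : List A := PiNat.res β n

lemma res_eq {A : Type} {β γ : ℕ → A} {n : ℕ} : res β n = res γ n ↔ ∀ i < n, β i = γ i :=
  PiNat.res_eq_res

lemma mem_res {A : Type} (β : ℕ → A) {i n : ℕ} (h : i < n) : β i ∈ res β n := by
  induction n with
  | zero => omega
  | succ n ih =>
    rw [res, PiNat.res_succ]
    rcases Nat.lt_succ_iff_lt_or_eq.1 h with h | h
    · exact List.mem_cons_of_mem _ (ih h)
    · subst h; exact List.mem_cons_self

def Dat.ms (Δ : Dat) (s : List Δ.A) : ℕ := (s.map Δ.lv).sum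

lemma lv_le_ms (β : ℕ → Δ.A) {i n : ℕ} (h : i < n) : Δ.lv (β i) ≤ Δ.ms (res β n) :=
  List.le_sum_of_mem (List.mem_map_of_mem (mem_res β h))

lemma ms_succ (β : ℕ → Δ.A) (n : ℕ) : Δ.ms (res β n) ≤ Δ.ms (res β (n + 1)) := by
  simp [Dat.ms, res, PiNat.res_succ]

abbrev Dat.VV (Δ : Dat) := (List Δ.A × ℕ) →₀ CantorC

/-- admissible vectors -/
def Adm (Δ : Dat) : Submodule ℝ Δ.VV where
  carrier := {v | ∀ q, IsLev (Δ.ms q.1) (v q) ∧ (v q ≠ 0 → q.2 = q.1.length ∨ q.2 + 1 = q.1.length)}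
  add_mem' := by
    intro v w hv hw q
    refine ⟨fun x y h => ?_, fun h => ?_⟩
    · simp [(hv q).1 x y h, (hw q).1 x y h]
    · by_cases h1 : v q = 0
      · by_cases h2 : w q = 0
        · exact absurd (by simp [h1, h2]) h
        · exact (hw q).2 h2
      · exact (hv q).2 h1
  zero_mem' := fun q => ⟨fun x y h => by simp, fun h => absurd rfl h⟩
  smul_mem' := by
    intro c v hv q
    refine ⟨fun x y h => ?_, fun h => ?_⟩
    · simp [(hv q).1 x y h]
    · exact (hv q).2 fun h1 => h (by simp [h1])

/-- elementary functionals -/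
structure El (Δ : Dat) where
  β : ℕ → Δ.A
  hβ : β ∈ Δ.B
  a : ℕ
  φ : CantorC →ₗ[ℝ] ℝ
  hφ : ∀ x, |φ x| ≤ ‖x‖
  ψ : ℕ → CantorC →ₗ[ℝ] ℝ
  hψ : ∀ k x, |ψ k x| ≤ ‖x‖
  comp : ∀ k, ∀ i < k, ψ k (Δ.D (β i)) = φ (Δ.D (β i))

def InT (e : El Δ) (s : List Δ.A) : Prop := s = res e.β s.length ∧ e.a ≤ s.length

open Classical in
def ev (e : El Δ) : Δ.VV →ₗ[ℝ] ℝ :=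
  Finsupp.lsum ℝ fun q => if InT e q.1 then e.ψ q.2 else 0

open Classical in
lemma ev_apply (e : El Δ) (v : Δ.VV) :
    ev e v = v.sum fun q z => if InT e q.1 then e.ψ q.2 z else 0 := by
  rw [ev, Finsupp.lsum_apply]
  refine Finsupp.sum_congr fun q _ => ?_
  split_ifs <;> simp

open Classical in
lemma ev_single (e : El Δ) (q : List Δ.A × ℕ) (z : CantorC) :
    ev e (Finsupp.single q z) = if InT e q.1 then e.ψ q.2 z else 0 := by
  rw [ev_apply, Finsupp.sum_single_index]
  simp

def Incomp (e e' : El Δ) : Prop := ∃ p, p < e.a ∧ p < e'.a ∧ e.β p ≠ e'.β p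

lemma Incomp.symm {e e' : El Δ} (h : Incomp e e') : Incomp e' e := by
  obtain ⟨p, h1, h2, h3⟩ := h; exact ⟨p, h2, h1, h3.symm⟩

def Fam (I : Finset ℕ) (F : ℕ → El Δ) : Prop := ∀ i ∈ I, ∀ j ∈ I, i ≠ j → Incomp (F i) (F j)

lemma Fam.disj {I : Finset ℕ} {F : ℕ → El Δ} (h : Fam I F) {i j : ℕ} (hi : i ∈ I) (hj : j ∈ I)
    {s : List Δ.A} (h1 : InT (F i) s) (h2 : InT (F j) s) : i = j := by
  by_contra hij
  obtain ⟨p, hp1, hp2, hp⟩ := h i hi j hj hij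
  have := h1.1.symm.trans h2.1
  rw [res_eq] at this
  exact hp (this p (hp1.trans_le h1.2))

structure Good (T : Dy →ₗ[ℝ] (El Δ → ℝ)) (M : ℝ) : Prop where
  bd : ∀ f r, Bd f r → ∀ I F, Fam I F → |∑ i ∈ I, T f (F i)| ≤ M * r
  app : ∀ f, ∀ ε > 0, ∃ v ∈ Adm Δ, ∀ I F, Fam I F → |∑ i ∈ I, (T f (F i) - ev (F i) v)| ≤ ε

lemma Fam.single (e : El Δ) : Fam {0} fun _ => e := by
  intro i hi j hj hij
  simp at hi hj; omega

lemma Good.bd1 {T : Dy →ₗ[ℝ] (El Δ → ℝ)} {M : ℝ} (hT : Good T M) {f r} (hf : Bd f r) (e : El Δ) :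
    |T f e| ≤ M * r := by
  simpa using hT.bd f r hf _ _ (Fam.single e)

lemma app1 {T : Dy →ₗ[ℝ] (El Δ → ℝ)} {f : Dy} {ε : ℝ} {v : Δ.VV}
    (h : ∀ I F, Fam I F → |∑ i ∈ I, (T f (F i) - ev (F i) v)| ≤ ε) (e : El Δ) :
    |T f e - ev e v| ≤ ε := by
  simpa using h _ _ (Fam.single e)

lemma Good.comp {T : Dy →ₗ[ℝ] (El Δ → ℝ)} {M K : ℝ} (hT : Good T M) (j : Dy →ₗ[ℝ] Dy)
    (hj : ∀ f r, Bd f r → Bd (j f) (K * r)) : Good (T.comp j) (M * K) := by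
  refine ⟨fun f r hf I F hF => ?_, fun f ε hε => hT.app (j f) ε hε⟩
  have := hT.bd (j f) (K * r) (hj f r hf) I F hF
  rw [mul_assoc]; exact this

def Sm (T : Dy →ₗ[ℝ] (El Δ → ℝ)) (Es : Set (El Δ)) : Prop :=
  ∀ (c : Cyl) (δ : ℝ), 0 < δ → ∃ h, IsH c h ∧ ∀ e ∈ Es, |T h e| ≤ δ

open Classical in
lemma Sm_empty (T : Dy →ₗ[ℝ] (El Δ → ℝ)) : Sm T ∅ := by
  intro c δ _
  refine ⟨⟨fun x => if c.mem x then 1 else 0, c.len, fun x y h => ?_⟩, ⟨?_, ?_, c.pt, ?_⟩, by simp⟩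
  · have : c.mem x ↔ c.mem y :=
      ⟨fun h' i hi => by rw [← h i hi, h' i hi], fun h' i hi => by rw [h i hi, h' i hi]⟩
    simp [this]
  · intro x hx; simp [hx]
  · intro x
    change |(if c.mem x then (1:ℝ) else 0)| ≤ 1
    split_ifs <;> simp
  · simp [Cyl.mem_pt]

/-- FC lemma -/
theorem FC {T : Dy →ₗ[ℝ] (El Δ → ℝ)} {M : ℝ} (hT : Good T M) {Es : Set (El Δ)} (hs : Sm T Es)
    (Q : Finset (List Δ.A × ℕ)) (c : Cyl) (δ : ℝ) (hδ : 0 < δ) :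
    ∃ h, ∃ v ∈ Adm Δ, IsH c h ∧ (∀ e ∈ Es, |T h e| ≤ δ) ∧
      (∀ I F, Fam I F → |∑ i ∈ I, (T h (F i) - ev (F i) v)| ≤ δ) ∧ ∀ q ∈ Q, v q = 0 := by
  let ι := Σ q : Q, (Fin (Δ.ms q.1.1) → Bool)
  let n := Fintype.card ι
  let δ' := δ / (n + 1)
  have hδ' : 0 < δ' := by positivity
  choose h hH hE using fun i : Fin (n+1) => hs (c.sub i) δ' hδ'
  choose v hv hvF using fun i : Fin (n+1) => hT.app (h i) δ' hδ'
  let ext : ∀ m : ℕ, (Fin m → Bool) → CantorSet := fun m u i =>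
    if h : i < m then u ⟨i, h⟩ else false
  let L : (Fin (n+1) → ℝ) →ₗ[ℝ] (ι → ℝ) :=
    { toFun := fun b x => ∑ i, b i * (v i x.1) (ext _ x.2)
      map_add' := fun b b' => by
        funext x; simp [add_mul, Finset.sum_add_distrib]
      map_smul' := fun r b => by
        funext x; simp [Finset.mul_sum, mul_assoc] }
  have hker : LinearMap.ker L ≠ ⊥ := LinearMap.ker_ne_bot_of_finrank_lt (by simp [n])
  obtain ⟨b, hb, hb0⟩ := (Submodule.ne_bot_iff _).1 hker
  obtain ⟨i0, -, hi0⟩ := Finset.exists_max_image Finset.univ (fun i => |b i|) Finset.univ_nonempty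
  have hbi0 : b i0 ≠ 0 := by
    intro h0
    apply hb0
    funext i
    have := hi0 i (Finset.mem_univ _)
    simp only [h0, abs_zero] at this
    simpa using this
  let b' : Fin (n+1) → ℝ := fun i => (b i0)⁻¹ * b i
  have hb'1 : ∀ i, |b' i| ≤ 1 := by
    intro i
    simp only [b']
    rw [abs_mul, abs_inv, inv_mul_le_iff₀ (abs_pos.2 hbi0), mul_one]
    exact hi0 i (Finset.mem_univ _)
  have hb'i0 : b' i0 = 1 := by simp [b', hbi0]
  have hLb' : L b' = 0 := by
    have : b' = (b i0)⁻¹ • b := rfl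
    rw [this, map_smul, LinearMap.mem_ker.1 hb, smul_zero]
  have hval : ∀ z i, ((c.sub (i : Fin (n+1))).mem z) → (∑ i, b' i • h i).1 z = b' i * (h i).1 z := by
    intro z i hz
    rw [Dy.sum_apply, Finset.sum_eq_single i]
    · rfl
    · intro k _ hk
      rw [Dy.smul_apply, (hH k).supp z (Cyl.sub_disj c (fun h => hk (Fin.ext h).symm) hz), mul_zero]
    · simp
  have hval0 : ∀ z, (∀ i : Fin (n+1), ¬ (c.sub i).mem z) → (∑ i, b' i • h i).1 z = 0 := by
    intro z hz
    rw [Dy.sum_apply]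
    refine Finset.sum_eq_zero fun i _ => ?_
    rw [Dy.smul_apply, (hH i).supp z (hz i), mul_zero]
  have bound : ∀ x : Fin (n+1) → ℝ, (∀ i, |x i| ≤ δ') → |∑ i, b' i * x i| ≤ δ := by
    intro x hx
    calc |∑ i, b' i * x i| ≤ ∑ i, |b' i * x i| := Finset.abs_sum_le_sum_abs _ _
      _ ≤ ∑ _i : Fin (n+1), δ' := by
        refine Finset.sum_le_sum fun i _ => ?_
        rw [abs_mul]
        have := mul_le_mul (hb'1 i) (hx i) (abs_nonneg _) zero_le_one
        linarith
      _ = δ := by simp [δ']; field_simp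
  refine ⟨∑ i, b' i • h i, ∑ i, b' i • v i, Submodule.sum_mem _ fun i _ =>
    Submodule.smul_mem _ _ (hv i), ⟨?_, ?_, ?_⟩, ?_, ?_, ?_⟩
  · intro z hz
    exact hval0 z fun i h' => hz (Cyl.sub_le _ _ _ h')
  · intro z
    by_cases hz : ∃ i : Fin (n+1), (c.sub i).mem z
    · obtain ⟨i, hi⟩ := hz
      rw [hval z i hi, abs_mul]
      have := mul_le_mul (hb'1 i) ((hH i).bd z) (abs_nonneg _) zero_le_one
      linarith
    · push Not at hz
      rw [hval0 z hz]; simp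
  · obtain ⟨x, hx⟩ := (hH i0).one
    refine ⟨x, ?_⟩
    have hxc : (c.sub i0).mem x := by
      by_contra hn
      have := (hH i0).supp x hn
      rw [hx] at this; exact one_ne_zero this
    rw [hval x i0 hxc, hb'i0, hx, one_mul]
  · intro e he
    have := bound (fun i => T (h i) e) fun i => hE i e he
    simpa [map_sum, map_smul, Finset.sum_apply] using this
  · intro I F hF
    have := bound (fun i => ∑ k ∈ I, (T (h i) (F k) - ev (F k) (v i))) fun i => hvF i I F hF
    convert this using 2
    simp only [Finset.mul_sum]
    rw [Finset.sum_comm]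
    refine Finset.sum_congr rfl fun k _ => ?_
    simp [map_sum, map_smul, Finset.sum_apply, mul_sub, Finset.sum_sub_distrib]
  · intro q hq
    ext z
    have h1 : ∀ i, (v i q) z = (v i q) (ext (Δ.ms q.1) fun k => z k) := fun i =>
      (hv i q).1 _ _ fun k hk => by simp [ext, hk]
    have h2 := congrFun hLb' ⟨⟨q, hq⟩, fun k => z k⟩
    simp only [L, LinearMap.coe_mk, AddHom.coe_mk, Pi.zero_apply] at h2
    rw [Finsupp.finsetSum_apply, ContinuousMap.coe_sum, Finset.sum_apply]
    simp only [Finsupp.smul_apply, ContinuousMap.smul_apply, smul_eq_mul, ContinuousMap.zero_apply]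
    rw [← h2]
    exact Finset.sum_congr rfl fun i _ => by rw [h1 i]

end
end NUB


namespace NUB
noncomputable section

variable {Δ : Dat}

lemma exists_sgn (x : ℝ) : ∃ s : ℝ, |s| = 1 ∧ s * x = |x| := by
  rcases le_total 0 x with h | h
  · exact ⟨1, by simp, by rw [abs_of_nonneg h, one_mul]⟩
  · exact ⟨-1, by simp, by rw [abs_of_nonpos h]; ring⟩

open Classical in
lemma ev_congr {e e' : El Δ} {v : Δ.VV} (r : ℝ)
    (h : ∀ q ∈ v.support, (InT e q.1 ↔ InT e' q.1) ∧
      (InT e q.1 → e.ψ q.2 (v q) = r * e'.ψ q.2 (v q))) :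
    ev e v = r * ev e' v := by
  rw [ev_apply, ev_apply, Finsupp.sum, Finsupp.sum, Finset.mul_sum]
  refine Finset.sum_congr rfl fun q hq => ?_
  obtain ⟨h1, h2⟩ := h q hq
  by_cases h' : InT e q.1
  · rw [if_pos h', if_pos (h1.1 h'), h2 h']
  · rw [if_neg h', if_neg (fun h3 => h' (h1.2 h3)), mul_zero]

theorem step_b1 {T : Dy →ₗ[ℝ] (El Δ → ℝ)} {M : ℝ} (hT : Good T M) {β : ℕ → Δ.A} (hβ : β ∈ Δ.B) :
    Sm T {e | e.β = β ∧ e.a = 0 ∧ e.φ = 0} := by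
  classical
  by_contra hcon
  simp only [Sm] at hcon
  push Not at hcon
  obtain ⟨c, δ, hδ, hbad⟩ := hcon
  let R : ℕ → Dy → (Δ.VV × El Δ) → ℕ → Prop := fun n h w n' =>
    n ≤ n' ∧ (∀ e, |T h e - ev e w.1| ≤ δ / 4) ∧
    (∀ q ∈ w.1.support, q.1 = res β q.1.length → n ≤ q.2 ∧ q.2 < n') ∧
    w.2 ∈ {e : El Δ | e.β = β ∧ e.a = 0 ∧ e.φ = 0} ∧ δ < |T h w.2|
  obtain ⟨h, w, n, n0, hR, hH, -, hBd⟩ := seq_trick R c 0 (by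
    intro c' hc' n
    let Q : Finset (List Δ.A × ℕ) := (Finset.range n).image (fun k => (res β k, k)) ∪
      (Finset.range n).image (fun k => (res β (k+1), k))
    obtain ⟨h, v, hv, hH, -, hF, hQ⟩ := FC hT (Sm_empty T) Q c' (δ/4) (by positivity)
    obtain ⟨e, he, he'⟩ := hbad h (hH.mono hc')
    refine ⟨h, (v, e), max n (v.support.sup (fun q => q.2) + 1), hH, le_max_left _ _, app1 hF,
      ?_, he, he'⟩
    intro q hq hqβ
    refine ⟨?_, ?_⟩
    · by_contra hlt
      push Not at hlt
      apply Finsupp.mem_support_iff.1 hq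
      apply hQ
      rcases (hv q).2 (Finsupp.mem_support_iff.1 hq) with h1 | h1
      · refine Finset.mem_union_left _ (Finset.mem_image.2 ⟨q.2, Finset.mem_range.2 hlt, ?_⟩)
        rw [← h1] at hqβ
        exact Prod.ext hqβ.symm rfl
      · refine Finset.mem_union_right _ (Finset.mem_image.2 ⟨q.2, Finset.mem_range.2 hlt, ?_⟩)
        rw [← h1] at hqβ
        exact Prod.ext hqβ.symm rfl
    · have := Finset.le_sup (f := fun q : List Δ.A × ℕ => q.2) hq
      simp only at this ⊢
      omega)
  have hmono : Monotone n := monotone_nat_of_le_succ fun j => (hR j).1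
  have huniq : ∀ i j k, n i ≤ k → k < n (i+1) → n j ≤ k → k < n (j+1) → i = j := by
    intro i j k h1 h2 h3 h4
    rcases lt_trichotomy i j with h | h | h
    · have := hmono (show i + 1 ≤ j from h); omega
    · exact h
    · have := hmono (show j + 1 ≤ i from h); omega
  choose s hs1 hs2 using fun j => exists_sgn (T (h j) (w j).2)
  let ψ : ℕ → CantorC →ₗ[ℝ] ℝ := fun k =>
    if hk : ∃ j, n j ≤ k ∧ k < n (j+1) then ((-1 : ℝ) ^ hk.choose * s hk.choose) •
      (w hk.choose).2.ψ k else 0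
  have hψj : ∀ j k, n j ≤ k → k < n (j+1) → ψ k = ((-1 : ℝ) ^ j * s j) • (w j).2.ψ k := by
    intro j k h1 h2
    have hk : ∃ j, n j ≤ k ∧ k < n (j+1) := ⟨j, h1, h2⟩
    have : hk.choose = j := huniq _ _ k hk.choose_spec.1 hk.choose_spec.2 h1 h2
    simp only [ψ]
    rw [dif_pos hk, this]
  have hψ0 : ∀ k, (¬ ∃ j, n j ≤ k ∧ k < n (j+1)) → ψ k = 0 := fun k hk => dif_neg hk
  let e : El Δ :=
    { β := β, hβ := hβ, a := 0, φ := 0, hφ := by simp, ψ := ψ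
      hψ := by
        intro k x
        by_cases hk : ∃ j, n j ≤ k ∧ k < n (j+1)
        · obtain ⟨j, h1, h2⟩ := hk
          rw [hψj j k h1 h2, LinearMap.smul_apply, smul_eq_mul, abs_mul, abs_mul,
            abs_neg_one_pow, hs1 j]
          simpa using (w j).2.hψ k x
        · rw [hψ0 k hk]; simp
      comp := by
        intro k i hik
        by_cases hk : ∃ j, n j ≤ k ∧ k < n (j+1)
        · obtain ⟨j, h1, h2⟩ := hk
          obtain ⟨a1, a2, a3⟩ := (hR j).2.2.2.1
          have := (w j).2.comp k i hik
          rw [a1, a3] at this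
          rw [hψj j k h1 h2]
          simp [this]
        · rw [hψ0 k hk] }
  have hev : ∀ j, ev e (w j).1 = ((-1 : ℝ) ^ j * s j) * ev (w j).2 (w j).1 := by
    intro j
    obtain ⟨a1, a2, a3⟩ := (hR j).2.2.2.1
    refine ev_congr _ fun q hq => ⟨?_, fun hin => ?_⟩
    · simp only [InT, a1, a2, e]
    · obtain ⟨b1, b2⟩ := (hR j).2.2.1 q hq hin.1
      change ψ q.2 _ = _
      rw [hψj j _ b1 b2]; simp
  have hterm : ∀ j, δ / 2 ≤ (-1 : ℝ) ^ j * T (h j) e := by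
    intro j
    have h1 := (hR j).2.1 e
    have h2 := (hR j).2.1 (w j).2
    have h3 := (hR j).2.2.2.2
    rw [hev j] at h1
    have h4 := hs2 j
    have e1 : ((-1 : ℝ) ^ j) * (-1 : ℝ) ^ j = 1 := by rw [← mul_pow]; simp
    have h5 : |(-1 : ℝ) ^ j * T (h j) e - s j * ev (w j).2 (w j).1| ≤ δ / 4 := by
      have : (-1 : ℝ) ^ j * T (h j) e - s j * ev (w j).2 (w j).1 = (-1 : ℝ) ^ j *
        (T (h j) e - ((-1 : ℝ) ^ j * s j) * ev (w j).2 (w j).1) := by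
        linear_combination (s j * ev (w j).2 (w j).1) * (1 * e1)
      rw [this, abs_mul, abs_neg_one_pow, one_mul]; exact h1
    have h6 : |s j * T (h j) (w j).2 - s j * ev (w j).2 (w j).1| ≤ δ / 4 := by
      rw [← mul_sub, abs_mul, hs1, one_mul]; exact h2
    rw [h4] at h6
    have := abs_le.1 h5
    have := abs_le.1 h6
    linarith [this.1, this.2]
  obtain ⟨N, hN⟩ := exists_nat_gt (M * 2 / (δ / 2))
  rw [div_lt_iff₀ (by positivity)] at hN
  have h1 := hT.bd1 (hBd N) e
  have h2 : T (∑ j ∈ Finset.range N, (-1 : ℝ) ^ j • h j) e =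
      ∑ j ∈ Finset.range N, (-1 : ℝ) ^ j * T (h j) e := by
    simp [map_sum, Finset.sum_apply]
  have h3 : N * (δ / 2) ≤ ∑ j ∈ Finset.range N, (-1 : ℝ) ^ j * T (h j) e := by
    calc (N : ℝ) * (δ/2) = ∑ j ∈ Finset.range N, δ / 2 := by simp
      _ ≤ _ := Finset.sum_le_sum fun j _ => hterm j
  rw [h2] at h1
  have := le_abs_self (∑ j ∈ Finset.range N, (-1 : ℝ) ^ j * T (h j) e)
  linarith

end
end NUB


namespace NUB
noncomputable section

variable {Δ : Dat}

lemma norming {E : Type*} [SeminormedAddCommGroup E] [NormedSpace ℝ E] (x : E) :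
    ∃ φ : E →ₗ[ℝ] ℝ, (∀ y, |φ y| ≤ ‖y‖) ∧ φ x = ‖x‖ := by
  obtain ⟨g, hg, hx⟩ := exists_dual_vector'' ℝ x
  refine ⟨(g : E →ₗ[ℝ] ℝ), fun y => ?_, by simpa using hx⟩
  have := g.le_of_opNorm_le hg y
  simpa using this

lemma dist_lemma {E : Type*} [SeminormedAddCommGroup E] [NormedSpace ℝ E] (F : Submodule ℝ E)
    (x : E) {η : ℝ} (hη : 0 < η) :
    ∃ ψ : E →ₗ[ℝ] ℝ, (∀ y, |ψ y| ≤ ‖y‖) ∧ (∀ y ∈ F, ψ y = 0) ∧ ∃ e ∈ F, ‖x - e‖ ≤ ψ x + η := by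
  obtain ⟨g, hg, hx⟩ := norming (E := E ⧸ F) (Submodule.Quotient.mk x)
  obtain ⟨m, hm, hmlt⟩ := Submodule.Quotient.norm_mk_lt (Submodule.Quotient.mk x : E ⧸ F) hη
  refine ⟨g.comp F.mkQ, fun y => (hg _).trans (Submodule.Quotient.norm_mk_le _ y), fun y hy => ?_,
    x - m, ?_, ?_⟩
  · simp [(Submodule.Quotient.mk_eq_zero F).2 hy]
  · exact (Submodule.Quotient.eq F).1 hm.symm
  · simp only [sub_sub_cancel, LinearMap.comp_apply, Submodule.mkQ_apply, hx]
    exact hmlt.le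

lemma IsLev.continuous {m : ℕ} {f : CantorSet → ℝ} (h : IsLev m f) : Continuous f := by
  rw [continuous_iff_continuousAt]
  intro x
  have hev : ∀ᶠ y in 𝓝 x, ∀ i ∈ Finset.range m, y i = x i := by
    rw [Finset.eventually_all]
    intro i _
    have : Continuous fun y : CantorSet => y i := continuous_apply i
    exact this.continuousAt.eventually (show ∀ᶠ b in 𝓝 (x i), b = x i by
      rw [nhds_discrete]; simp)
  refine ContinuousAt.congr (f := fun _ => f x) continuousAt_const ?_
  filter_upwards [hev] with y hy
  exact h _ _ fun i hi => (hy i (Finset.mem_range.2 hi)).symm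

def toC : Dy →ₗ[ℝ] CantorC where
  toFun f := ⟨f.1, f.2.choose_spec.continuous⟩
  map_add' _ _ := rfl
  map_smul' _ _ := rfl

@[simp] lemma toC_apply (f : Dy) (z : CantorSet) : toC f z = f.1 z := rfl

lemma Bd_toC (f : Dy) : Bd f ‖toC f‖ := fun z => (toC f).norm_coe_le_norm z

lemma norm_toC_le {f : Dy} {r : ℝ} (h : Bd f r) : ‖toC f‖ ≤ r :=
  ((toC f).norm_le h.nonneg).2 h

lemma toC_dense : DenseRange toC := by
  let Alg : Subalgebra ℝ CantorC :=
    { carrier := Set.range toC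
      add_mem' := by rintro _ _ ⟨f, rfl⟩ ⟨g, rfl⟩; exact ⟨f + g, map_add _ _ _⟩
      mul_mem' := by
        rintro _ _ ⟨f, rfl⟩ ⟨g, rfl⟩
        obtain ⟨m, hm⟩ := f.2
        obtain ⟨n, hn⟩ := g.2
        refine ⟨⟨f.1 * g.1, max m n, fun x y h => ?_⟩, rfl⟩
        simp only [Pi.mul_apply]
        rw [(hm.mono (le_max_left m n)) x y h, (hn.mono (le_max_right m n)) x y h]
      algebraMap_mem' := fun r => ⟨⟨fun _ => r, 0, fun _ _ _ => rfl⟩, rfl⟩ }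
  have hsep : Alg.SeparatesPoints := by
    intro x y hxy
    obtain ⟨i, hi⟩ := Function.ne_iff.1 hxy
    refine ⟨_, ⟨toC ⟨fun z => if z i = true then 1 else 0, i + 1, fun u v h => ?_⟩, ⟨_, rfl⟩, rfl⟩, ?_⟩
    · simp [h i (Nat.lt_succ_self i)]
    · simp only [toC_apply]
      cases hx : x i <;> cases hy : y i <;> simp_all
  have := ContinuousMap.subalgebra_topologicalClosure_eq_top_of_separatesPoints Alg hsep
  intro x
  have hx : x ∈ Alg.topologicalClosure := by rw [this]; trivial
  exact hx

lemma embed_of_step {Y : Type*} [NormedAddCommGroup Y] [NormedSpace ℝ Y] [CompleteSpace Y]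
    (S : Dy →ₗ[ℝ] Y) (K δ : ℝ) (hδ : 0 < δ)
    (hK : ∀ f r, Bd f r → ‖S f‖ ≤ K * r) (hl : ∀ f z, δ * |f.1 z| ≤ ‖S f‖) : Embeds CantorC Y := by
  have hC : ∃ C, ∀ f, ‖S f‖ ≤ C * ‖toC f‖ := ⟨K, fun f => hK _ _ (Bd_toC f)⟩
  have key := LinearMap.extendOfNorm_eq (f := S) toC_dense hC
  refine ⟨S.extendOfNorm toC, δ, hδ, fun x => ?_⟩
  refine toC_dense.induction (P := fun x => δ * ‖x‖ ≤ ‖S.extendOfNorm toC x‖) ?_ ?_ x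
  · rintro _ ⟨f, rfl⟩
    rw [key f, mul_comm, ← le_div_iff₀ hδ]
    refine norm_toC_le fun z => ?_
    rw [le_div_iff₀ hδ, mul_comm]; exact hl f z
  · exact isClosed_le (by fun_prop) (by fun_prop)

open Classical in
lemma ev_fib (e : El Δ) (ha : e.a = 0) (v : Δ.VV) (K : ℕ) (hK : ∀ q ∈ v.support, q.2 < K) :
    ev e v = ∑ k ∈ Finset.range K, e.ψ k (∑ q ∈ v.support.filter
      (fun q => q.1 = res e.β q.1.length ∧ q.2 = k), v q) := by
  rw [ev_apply, Finsupp.sum, ← Finset.sum_fiberwise_of_maps_to (t := Finset.range K)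
    (g := fun q : List Δ.A × ℕ => q.2) (fun q hq => Finset.mem_range.2 (hK q hq))]
  refine Finset.sum_congr rfl fun k _ => ?_
  rw [map_sum, Finset.sum_filter, Finset.sum_filter]
  refine Finset.sum_congr rfl fun q _ => ?_
  by_cases h1 : q.2 = k
  · by_cases h2 : q.1 = res e.β q.1.length
    · rw [if_pos h1, if_pos (show InT e q.1 from ⟨h2, by omega⟩),
        if_pos (show q.1 = res e.β q.1.length ∧ q.2 = k from ⟨h2, h1⟩), h1]
    · rw [if_pos h1, if_neg fun h => h2 h.1, if_neg fun h => h2 h.1]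
  · rw [if_neg h1, if_neg fun h => h1 h.2]

lemma comp_span (e : El Δ) (k : ℕ) {x : CantorC}
    (hx : x ∈ Submodule.span ℝ ((fun i => Δ.D (e.β i)) '' Set.Iio k)) : e.ψ k x = e.φ x := by
  induction hx using Submodule.span_induction with
  | mem x h => obtain ⟨i, hi, rfl⟩ := h; exact e.comp k i hi
  | zero => simp
  | add x y _ _ h1 h2 => simp [h1, h2]
  | smul a x _ h => simp [h]

lemma step_b2a {T : Dy →ₗ[ℝ] (El Δ → ℝ)} {M : ℝ} (hT : Good T M) {β : ℕ → Δ.A} (hβ : β ∈ Δ.B)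
    (c : Cyl) (ε : ℝ) (hε : 0 < ε) : ∃ h, ∃ x ∈ Submodule.span ℝ (Set.range fun i => Δ.D (β i)),
      IsH c h ∧ ∀ e : El Δ, e.β = β → e.a = 0 → |T h e - e.φ x| ≤ ε := by
  classical
  let η := ε / 4
  have hη : 0 < η := by positivity
  obtain ⟨h, v, hv, hH, hsm, hF, -⟩ := FC hT (step_b1 hT hβ) ∅ c η hη
  let K := v.support.sup (fun q => q.2) + 1
  have hK : ∀ q ∈ v.support, q.2 < K := fun q hq => by
    have := Finset.le_sup (f := fun q : List Δ.A × ℕ => q.2) hq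
    simp only [K] at this ⊢
    omega
  let cc : ℕ → CantorC := fun k => ∑ q ∈ v.support.filter
      (fun q => q.1 = res β q.1.length ∧ q.2 = k), v q
  let E : ℕ → Submodule ℝ CantorC := fun k => Submodule.span ℝ ((fun i => Δ.D (β i)) '' Set.Iio k)
  have hη' : 0 < η / K := by
    have : (0 : ℝ) < K := by simp only [K]; positivity
    positivity
  choose ψ hψ1 hψ2 x hx1 hx2 using fun k => dist_lemma (E k) (cc k) hη'
  let e0 : El Δ :=
    { β := β, hβ := hβ, a := 0, φ := 0, hφ := fun x => by simp, ψ := ψ, hψ := hψ1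
      comp := fun k i hik => by
        rw [hψ2 k _ (Submodule.subset_span ⟨i, hik, rfl⟩)]; rfl }
  have h0 := hsm e0 ⟨rfl, rfl, rfl⟩
  have h1 := app1 hF e0
  have h2 : ev e0 v = ∑ k ∈ Finset.range K, ψ k (cc k) := ev_fib e0 rfl v K hK
  have h3 : ∑ k ∈ Finset.range K, ‖cc k - x k‖ ≤ 3 * η := by
    have : ∑ k ∈ Finset.range K, ‖cc k - x k‖ ≤ ∑ k ∈ Finset.range K, (ψ k (cc k) + η / K) :=
      Finset.sum_le_sum fun k _ => hx2 k
    rw [Finset.sum_add_distrib, ← h2, Finset.sum_const, Finset.card_range, nsmul_eq_mul,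
      mul_div_cancel₀] at this
    · have := abs_le.1 h0; have := abs_le.1 h1; linarith [this.1, this.2]
    · simp only [K]; positivity
  refine ⟨h, ∑ k ∈ Finset.range K, x k, Submodule.sum_mem _ fun k _ =>
    Submodule.span_mono (by rintro _ ⟨i, _, rfl⟩; exact ⟨i, rfl⟩) (hx1 k), hH, ?_⟩
  rintro e rfl hea
  have h4 := app1 hF e
  have h5 : ev e v = ∑ k ∈ Finset.range K, e.ψ k (cc k) := ev_fib e hea v K hK
  have h6 : |ev e v - e.φ (∑ k ∈ Finset.range K, x k)| ≤ 3 * η := by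
    rw [h5, map_sum, ← Finset.sum_sub_distrib]
    refine (Finset.abs_sum_le_sum_abs _ _).trans (le_trans (Finset.sum_le_sum fun k _ => ?_) h3)
    rw [← comp_span e k (hx1 k), ← map_sub]
    exact e.hψ _ _
  have h7 := abs_le.1 h4
  have h8 := abs_le.1 h6
  rw [abs_le]
  simp only [η] at h7 h8
  constructor <;> linarith [h7.1, h7.2, h8.1, h8.2]

def constEl (β : ℕ → Δ.A) (hβ : β ∈ Δ.B) (a : ℕ) (φ : CantorC →ₗ[ℝ] ℝ) (hφ : ∀ x, |φ x| ≤ ‖x‖) :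
    El Δ :=
  { β := β, hβ := hβ, a := a, φ := φ, hφ := hφ, ψ := fun _ => φ, hψ := fun _ => hφ
    comp := fun _ _ _ => rfl }

theorem step_b2 {T : Dy →ₗ[ℝ] (El Δ → ℝ)} {M : ℝ} (hT : Good T M) {β : ℕ → Δ.A} (hβ : β ∈ Δ.B) :
    Sm T {e | e.β = β ∧ e.a = 0} := by
  intro c δ hδ
  let X := Submodule.span ℝ (Set.range fun i => Δ.D (β i))
  let N : {e : El Δ // e.β = β ∧ e.a = 0} → (Dy × X →ₗ[ℝ] ℝ) := fun e =>
    ((LinearMap.proj e.1).comp T).comp (LinearMap.fst ℝ Dy X) -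
      (e.1.φ.comp X.subtype).comp (LinearMap.snd ℝ Dy X)
  have hNa : ∀ e f x, N e (f, x) = T f e.1 - e.1.φ x := fun e f x => rfl
  obtain ⟨j, S, hj1, hj2, hj3, hj4⟩ := copy_lemma N (by
    intro c ε hε
    obtain ⟨h, x, hx, hH, hh⟩ := step_b2a hT hβ c ε hε
    exact ⟨h, ⟨x, hx⟩, hH, fun e => hh e.1 e.2.1 e.2.2⟩) c (δ/2) (by positivity)
  have hSb : ∀ f r, Bd f r → ‖S f‖ ≤ (M * 3 + δ / 2) * r := by
    intro f r hf
    obtain ⟨φ, hφ, hφx⟩ := norming (S f : CantorC)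
    have h1 := hj4 f r hf ⟨constEl β hβ 0 φ hφ, rfl, rfl⟩
    rw [hNa] at h1
    change |T (j f) (constEl β hβ 0 φ hφ) - φ (S f)| ≤ _ at h1
    rw [hφx] at h1
    have h2 := hT.bd1 (hj2 f r hf) (constEl β hβ 0 φ hφ)
    have h1 := abs_le.1 h1
    have h2 := abs_le.1 h2
    change ‖(S f : CantorC)‖ ≤ _
    linarith [h1.1, h2.2]
  by_contra hcon
  apply Δ.nonuniv β hβ
  refine embed_of_step ((Submodule.inclusion X.le_topologicalClosure).comp S) (M * 3 + δ / 2) (δ / 2)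
    (by positivity) hSb ?_
  by_contra hcon2
  push Not at hcon2
  obtain ⟨f, z, hfz⟩ := hcon2
  change ‖(S f : CantorC)‖ < _ at hfz
  obtain ⟨z0, hz0⟩ := exists_max f
  set r := |f.1 z0| with hr
  have hrpos : 0 < r := by
    have h1 : 0 < δ / 2 * |f.1 z| := (norm_nonneg _).trans_lt hfz
    have h2 : 0 < |f.1 z| := by
      by_contra h; push Not at h
      nlinarith
    exact h2.trans_le (hz0 z)
  have hS : ‖(S f : CantorC)‖ ≤ δ / 2 * r := hfz.le.trans (by gcongr; exact hz0 z)
  obtain ⟨z1, hz1⟩ := hj3 f z0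
  obtain ⟨b, hb, hbH⟩ := exists_normalize (hj1 f) r hrpos (z := z1) (by rw [hz1])
  apply hcon
  refine ⟨b • j f, hbH, fun e he => ?_⟩
  have h1 := hj4 f r hz0 ⟨e, he⟩
  rw [hNa] at h1
  have h2 := e.hφ (S f)
  have h3 : |T (j f) e| ≤ δ * r := by
    have h1 := abs_le.1 h1
    have h2 := abs_le.1 h2
    rw [abs_le]
    constructor <;> linarith [h1.1, h1.2, h2.1, h2.2]
  rw [map_smul, Pi.smul_apply, smul_eq_mul, abs_mul]
  calc |b| * |T (j f) e| ≤ (1 / r) * (δ * r) := by gcongr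
    _ = δ := by field_simp

end
end NUB


namespace NUB
noncomputable section

variable {Δ : Dat}

lemma Supp.sum {c : Cyl} {h : ℕ → Dy} (hh : ∀ j, Supp c (h j)) (I : Finset ℕ) (b : ℕ → ℝ) :
    Supp c (∑ j ∈ I, b j • h j) := by
  intro z hz
  rw [Dy.sum_apply]
  exact Finset.sum_eq_zero fun j _ => by rw [Dy.smul_apply, hh j z hz, mul_zero]

def El.at (e : El Δ) (a : ℕ) : El Δ := { e with a := a }

theorem step_a {T : Dy →ₗ[ℝ] (El Δ → ℝ)} {M : ℝ} (hT : Good T M) {β : ℕ → Δ.A} (hβ : β ∈ Δ.B) :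
    Sm T {e | e.β = β} := by
  classical
  intro c δ hδ
  have hε : 0 < δ / 6 := by positivity
  let R : ℕ → Dy → Δ.VV → ℕ → Prop := fun n h v n' =>
    n ≤ n' ∧ (∀ e, |T h e - ev e v| ≤ δ / 6) ∧
    (∀ q ∈ v.support, q.1 = res β q.1.length → n ≤ q.1.length ∧ q.1.length < n') ∧
    ∀ e : El Δ, e.β = β → e.a = 0 → |T h e| ≤ δ / 6
  obtain ⟨h, v, n, n0, hR, hH, hone, -⟩ := seq_trick R c 0 (by
    intro c' hc' n
    let Q : Finset (List Δ.A × ℕ) := (Finset.range n).image (fun i => (res β i, i)) ∪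
      (Finset.range n).image (fun i => (res β i, i - 1))
    obtain ⟨h, v, hv, hH, hsm, hF, hQ⟩ := FC hT (step_b2 hT hβ) Q c' (δ/6) hε
    refine ⟨h, v, max n (v.support.sup (fun q => q.1.length) + 1), hH, le_max_left _ _, app1 hF,
      ?_, fun e h1 h2 => hsm e ⟨h1, h2⟩⟩
    intro q hq hqβ
    refine ⟨?_, ?_⟩
    · by_contra hlt
      push Not at hlt
      apply Finsupp.mem_support_iff.1 hq
      apply hQ
      rcases (hv q).2 (Finsupp.mem_support_iff.1 hq) with h1 | h1
      · refine Finset.mem_union_left _ (Finset.mem_image.2 ⟨_, Finset.mem_range.2 hlt, ?_⟩)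
        exact Prod.ext hqβ.symm h1.symm
      · refine Finset.mem_union_right _ (Finset.mem_image.2 ⟨_, Finset.mem_range.2 hlt, ?_⟩)
        exact Prod.ext hqβ.symm (by simp only; omega)
    · have := Finset.le_sup (f := fun q : List Δ.A × ℕ => q.1.length) hq
      exact lt_max_of_lt_right (Nat.lt_succ_of_le this))
  have hmono : Monotone n := monotone_nat_of_le_succ fun j => (hR j).1
  have hterm : ∀ e : El Δ, e.β = β → ∀ j, |T (h j) e| ≤ δ / 2 +
      if n j < e.a ∧ e.a < n (j+1) then M else 0 := by
    intro e he j
    obtain ⟨-, h1, h2, h3⟩ := hR j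
    by_cases hlow : e.a ≤ n j
    · have e1 : ev e (v j) = 1 * ev (e.at 0) (v j) := by
        refine ev_congr 1 fun q hq => ⟨⟨fun h => ⟨h.1, Nat.zero_le _⟩, fun h => ⟨h.1, ?_⟩⟩,
          fun _ => (one_mul _).symm⟩
        have h5 : q.1 = res e.β q.1.length := h.1
        rw [he] at h5
        exact hlow.trans (h2 q hq h5).1
      have a1 := abs_le.1 (h1 e)
      have a2 := abs_le.1 (h1 (e.at 0))
      have a3 := abs_le.1 (h3 (e.at 0) he rfl)
      rw [if_neg (by omega), abs_le]
      constructor <;> linarith [a1.1, a1.2, a2.1, a2.2, a3.1, a3.2]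
    · by_cases hhigh : n (j+1) ≤ e.a
      · have e1 : ev e (v j) = 0 := by
          rw [ev_apply]
          refine Finset.sum_eq_zero fun q hq => if_neg fun h => ?_
          have h5 := h.1
          rw [he] at h5
          have := (h2 q hq h5).2
          have := h.2
          omega
        have a1 := h1 e
        rw [e1, sub_zero] at a1
        rw [if_neg (by omega)]; linarith
      · rw [if_pos (by omega)]
        have := hT.bd1 (hH j).bd e
        linarith
  have hM : ∀ e : El Δ, 0 ≤ M := fun e => by
    have := (abs_nonneg _).trans (hT.bd1 (hH 0).bd e); linarith
  obtain ⟨N, hN⟩ := exists_nat_gt (max (2 * M / δ) 0)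
  have hN1 : 2 * M / δ < N := (le_max_left _ _).trans_lt hN
  have hN0 : (0 : ℝ) < N := (le_max_right _ _).trans_lt hN
  have hsum : ∀ e : El Δ, e.β = β → |T (∑ j ∈ Finset.range N, h j) e| ≤ δ * N := by
    intro e he
    have h1 : T (∑ j ∈ Finset.range N, h j) e = ∑ j ∈ Finset.range N, T (h j) e := by
      simp [map_sum, Finset.sum_apply]
    rw [h1]
    have h2 : ∑ j ∈ Finset.range N, (if n j < e.a ∧ e.a < n (j+1) then M else 0) ≤ M := by
      by_cases hex : ∃ j, n j < e.a ∧ e.a < n (j+1)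
      · obtain ⟨j, hj1, hj2⟩ := hex
        calc ∑ i ∈ Finset.range N, (if n i < e.a ∧ e.a < n (i+1) then M else 0)
            ≤ ∑ i ∈ Finset.range N, if j = i then M else 0 := by
              refine Finset.sum_le_sum fun i _ => ?_
              split_ifs with h3 h4 h4
              · exact le_rfl
              · exfalso
                apply h4
                rcases lt_trichotomy i j with h | h | h
                · have := hmono (show i + 1 ≤ j from h); omega
                · exact h.symm
                · have := hmono (show j + 1 ≤ i from h); omega
              · exact hM e
              · exact le_rfl
          _ ≤ M := by
              rw [Finset.sum_ite_eq]
              split_ifs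
              · exact le_rfl
              · exact hM e
      · rw [Finset.sum_eq_zero fun j _ => if_neg fun h => hex ⟨j, h⟩]; exact hM e
    calc |∑ j ∈ Finset.range N, T (h j) e| ≤ ∑ j ∈ Finset.range N, |T (h j) e| :=
          Finset.abs_sum_le_sum_abs _ _
      _ ≤ ∑ j ∈ Finset.range N, (δ / 2 + if n j < e.a ∧ e.a < n (j+1) then M else 0) :=
          Finset.sum_le_sum fun j _ => hterm e he j
      _ ≤ N * (δ / 2) + M := by
          rw [Finset.sum_add_distrib, Finset.sum_const, Finset.card_range, nsmul_eq_mul]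
          linarith
      _ ≤ δ * N := by
          rw [div_lt_iff₀ hδ] at hN1
          linarith
  obtain ⟨z, hz⟩ := hone N
  have hsupp : Supp c (∑ j ∈ Finset.range N, h j) := by
    simpa using Supp.sum (fun j => (hH j).supp) (Finset.range N) fun _ => 1
  obtain ⟨b, hb, hbH⟩ := exists_normalize hsupp N hN0 (z := z) (by rw [hz]; exact le_abs_self _)
  refine ⟨_, hbH, fun e he => ?_⟩
  rw [map_smul, Pi.smul_apply, smul_eq_mul, abs_mul]
  calc _ ≤ (1 / N) * (δ * N) := by gcongr; exact hsum e he
    _ = δ := by field_simp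

/-- small on finitely many branches -/
theorem step_c (l : List (ℕ → Δ.A)) (hl : ∀ β ∈ l, β ∈ Δ.B) :
    ∀ {T : Dy →ₗ[ℝ] (El Δ → ℝ)} {M : ℝ}, Good T M → Sm T {e | e.β ∈ l} := by
  induction l with
  | nil =>
    intro T M hT
    simpa using Sm_empty T
  | cons β l ih =>
    intro T M hT c δ hδ
    have ha := step_a hT (hl β List.mem_cons_self)
    let N : {e : El Δ // e.β = β} → (Dy × ℝ →ₗ[ℝ] ℝ) := fun e =>
      ((LinearMap.proj e.1).comp T).comp (LinearMap.fst ℝ Dy ℝ)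
    obtain ⟨j, S, hj1, hj2, hj3, hj4⟩ := copy_lemma N (by
      intro c ε hε
      obtain ⟨h, hH, hh⟩ := ha c ε hε
      exact ⟨h, 0, hH, fun e => hh e.1 e.2⟩) c δ hδ
    have hT' := hT.comp j hj2
    obtain ⟨h, hH, hh⟩ := ih (fun β hβ => hl β (List.mem_cons_of_mem _ hβ)) hT' Cyl.top δ hδ
    obtain ⟨z, hz⟩ := hH.one
    obtain ⟨z', hz'⟩ := hj3 h z
    obtain ⟨b, hb, hbH⟩ := exists_normalize (hj1 h) 1 one_pos (z := z') (by rw [hz', hz]; simp)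
    refine ⟨_, hbH, fun e he => ?_⟩
    have key : |T (j h) e| ≤ δ := by
      rcases List.mem_cons.1 he with h1 | h1
      · have := hj4 h 1 hH.bd ⟨e, h1⟩
        rw [mul_one] at this; exact this
      · exact hh e h1
    rw [map_smul, Pi.smul_apply, smul_eq_mul, abs_mul]
    calc |b| * |T (j h) e| ≤ (1 / 1) * δ := by gcongr
      _ = δ := by ring

end
end NUB


namespace NUB
noncomputable section

variable {Δ : Dat}

/-- linear relations transfer from `ev` to good operators -/
lemma Good.rel {T : Dy →ₗ[ℝ] (El Δ → ℝ)} {M : ℝ} (hT : Good T M) {n : ℕ} (r : Fin n → ℝ)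
    (F : Fin n → El Δ) (h : ∀ v ∈ Adm Δ, ∑ k, r k * ev (F k) v = 0) (f : Dy) :
    ∑ k, r k * T f (F k) = 0 := by
  by_contra hne
  have hpos := abs_pos.2 hne
  set A := |∑ k, r k * T f (F k)| with hA
  have hS : 0 ≤ ∑ k, |r k| := Finset.sum_nonneg fun _ _ => abs_nonneg _
  obtain ⟨v, hv, hF⟩ := hT.app f (A / (2 * (∑ k, |r k| + 1))) (by positivity)
  have h1 : A ≤ (∑ k, |r k|) * (A / (2 * (∑ k, |r k| + 1))) := by
    have : ∑ k, r k * T f (F k) = ∑ k, r k * (T f (F k) - ev (F k) v) := by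
      simp only [mul_sub, Finset.sum_sub_distrib]
      rw [h v hv, sub_zero]
    refine hA.le.trans ?_
    rw [this, Finset.sum_mul]
    refine (Finset.abs_sum_le_sum_abs _ _).trans (Finset.sum_le_sum fun k _ => ?_)
    rw [abs_mul]
    exact mul_le_mul_of_nonneg_left (app1 hF _) (abs_nonneg _)
  have h2 : (∑ k, |r k|) * (A / (2 * (∑ k, |r k| + 1))) < A := by
    rw [mul_div_assoc', div_lt_iff₀ (by positivity)]
    nlinarith
  linarith

def El.neg (e : El Δ) : El Δ :=
  { e with
    φ := -e.φ
    hφ := fun x => by simpa using e.hφ x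
    ψ := fun k => -e.ψ k
    hψ := fun k x => by simpa using e.hψ k x
    comp := fun k i h => by simp [e.comp k i h] }

lemma ev_neg (e : El Δ) (v : Δ.VV) : ev e.neg v = - ev e v := by
  rw [ev_congr (e := e.neg) (e' := e) (-1)]
  · ring
  · exact fun q _ => ⟨Iff.rfl, fun _ => by simp [El.neg]⟩

lemma Good.neg {T : Dy →ₗ[ℝ] (El Δ → ℝ)} {M : ℝ} (hT : Good T M) (e : El Δ) (f : Dy) :
    T f e.neg = - T f e := by
  have := hT.rel ![1, 1] ![e.neg, e] (fun v _ => by simp [Fin.sum_univ_two, ev_neg]) f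
  simp [Fin.sum_univ_two] at this
  linarith

lemma selection (m : ℕ) : ∀ (J : Finset ℕ) (I : ℕ → Finset ℕ) (F : ℕ → ℕ → El Δ), J.card = m →
    (∀ i ∈ J, m ≤ (I i).card) → (∀ i ∈ J, Fam (I i) (F i)) →
    ∃ g : ℕ → ℕ, (∀ i ∈ J, g i ∈ I i) ∧ Fam J (fun i => F i (g i)) := by
  classical
  induction m with
  | zero =>
    intro J I F hJ _ _
    rw [Finset.card_eq_zero] at hJ
    subst hJ
    exact ⟨fun _ => 0, by simp, by intro i hi; simp at hi⟩
  | succ m ih =>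
    intro J I F hJ hI hF
    have hJne : J.Nonempty := Finset.card_pos.1 (by omega)
    obtain ⟨j0, hj0⟩ := hJne
    have hI0 : (I j0).Nonempty := Finset.card_pos.1 (by have := hI j0 hj0; omega)
    obtain ⟨t1, ht1⟩ := hI0
    obtain ⟨⟨i0, t0⟩, hmem, hmax⟩ := Finset.exists_max_image (J.sigma I)
      (fun p => (F p.1 p.2).a) ⟨⟨j0, t1⟩, Finset.mem_sigma.2 ⟨hj0, ht1⟩⟩
    obtain ⟨hi0, ht0⟩ := Finset.mem_sigma.1 hmem
    simp only at hi0 ht0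
    let I' : ℕ → Finset ℕ := fun i => (I i).filter fun t => Incomp (F i t) (F i0 t0)
    obtain ⟨g, hg1, hg2⟩ := ih (J.erase i0) I' F (by rw [Finset.card_erase_of_mem hi0]; omega) (by
      intro i hi
      have hiJ := Finset.mem_of_mem_erase hi
      have h1 := Finset.card_filter_add_card_filter_not (s := I i) (fun t => Incomp (F i t) (F i0 t0))
      have h2 : ((I i).filter fun t => ¬ Incomp (F i t) (F i0 t0)).card ≤ 1 := by
        rw [Finset.card_le_one]
        intro t ht t' ht'
        obtain ⟨ht, hnt⟩ := Finset.mem_filter.1 ht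
        obtain ⟨ht', hnt'⟩ := Finset.mem_filter.1 ht'
        by_contra hne
        obtain ⟨p, hp1, hp2, hp3⟩ := hF i hiJ t ht t' ht' hne
        have m1 := hmax ⟨i, t⟩ (Finset.mem_sigma.2 ⟨hiJ, ht⟩)
        simp only at m1
        by_cases hb : (F i t).β p = (F i0 t0).β p
        · exact hnt' ⟨p, hp2, hp1.trans_le m1, fun h => hp3 (hb.trans h.symm)⟩
        · exact hnt ⟨p, hp1, hp1.trans_le m1, hb⟩
      have := hI i hiJ
      simp only [I']
      omega) (fun i hi t ht t' ht' hne => hF i (Finset.mem_of_mem_erase hi) t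
        (Finset.mem_of_mem_filter _ ht) t' (Finset.mem_of_mem_filter _ ht') hne)
    refine ⟨Function.update g i0 t0, fun i hi => ?_, fun i hi j hj hij => ?_⟩
    · by_cases h : i = i0
      · subst h; simpa using ht0
      · rw [Function.update_of_ne h]
        exact Finset.mem_of_mem_filter _ (hg1 i (Finset.mem_erase.2 ⟨h, hi⟩))
    · by_cases h : i = i0
      · subst h
        have hji : j ≠ i := hij.symm
        simp only [Function.update_self, Function.update_of_ne hji]
        exact (Finset.mem_filter.1 (hg1 j (Finset.mem_erase.2 ⟨hji, hj⟩))).2.symm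
      · by_cases h' : j = i0
        · subst h'
          simp only [Function.update_self, Function.update_of_ne h]
          exact (Finset.mem_filter.1 (hg1 i (Finset.mem_erase.2 ⟨h, hi⟩))).2
        · simp only [Function.update_of_ne h, Function.update_of_ne h']
          exact hg2 i (Finset.mem_erase.2 ⟨h, hi⟩) j (Finset.mem_erase.2 ⟨h', hj⟩) hij

lemma sign_lemma (x : ℕ → ℕ → ℝ) (J : Finset ℕ) : ∃ θ : ℕ → ℝ, (∀ j, |θ j| = 1) ∧
    ∑ i ∈ J, |x i i| ≤ ∑ i ∈ J, |∑ j ∈ J, θ j * x i j| := by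
  classical
  induction J using Finset.induction_on with
  | empty => exact ⟨fun _ => 1, by simp, by simp⟩
  | insert k J hk ih =>
    obtain ⟨θ, hθ, hle⟩ := ih
    let G : ℝ → ℝ := fun s => ∑ i ∈ insert k J, |s * x i k + ∑ j ∈ J, θ j * x i j|
    have hG : 2 * ∑ i ∈ insert k J, |x i i| ≤ G 1 + G (-1) := by
      simp only [G]
      rw [← Finset.sum_add_distrib, Finset.sum_insert hk, Finset.sum_insert hk, mul_add]
      refine add_le_add ?_ ?_
      · have := abs_sub (1 * x k k + ∑ j ∈ J, θ j * x k j) (-1 * x k k + ∑ j ∈ J, θ j * x k j)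
        have h2 : 1 * x k k + ∑ j ∈ J, θ j * x k j - (-1 * x k k + ∑ j ∈ J, θ j * x k j) = 2 * x k k := by
          ring
        rw [h2, abs_mul] at this
        simpa using this
      · refine (mul_le_mul_of_nonneg_left hle zero_le_two).trans ?_
        rw [Finset.mul_sum]
        refine Finset.sum_le_sum fun i _ => ?_
        have := abs_add_le (1 * x i k + ∑ j ∈ J, θ j * x i j) (-1 * x i k + ∑ j ∈ J, θ j * x i j)
        have h2 : 1 * x i k + ∑ j ∈ J, θ j * x i j + (-1 * x i k + ∑ j ∈ J, θ j * x i j) =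
          2 * ∑ j ∈ J, θ j * x i j := by ring
        rw [h2, abs_mul] at this
        simpa using this
    have key : ∀ s : ℝ, |s| = 1 → ∑ i ∈ insert k J, |x i i| ≤ G s → ∃ θ : ℕ → ℝ, (∀ j, |θ j| = 1) ∧
        ∑ i ∈ insert k J, |x i i| ≤ ∑ i ∈ insert k J, |∑ j ∈ insert k J, θ j * x i j| := by
      intro s hs h
      refine ⟨Function.update θ k s, fun j => ?_, h.trans (le_of_eq ?_)⟩
      · by_cases hj : j = k
        · subst hj; simpa using hs
        · rw [Function.update_of_ne hj]; exact hθ j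
      · refine Finset.sum_congr rfl fun i _ => ?_
        rw [Finset.sum_insert hk, Function.update_self]
        congr 2
        refine Finset.sum_congr rfl fun j hj => ?_
        rw [Function.update_of_ne (fun h : j = k => hk (h ▸ hj))]
    by_cases h : ∑ i ∈ insert k J, |x i i| ≤ G 1
    · exact key 1 (by simp) h
    · exact key (-1) (by simp) (by push Not at h; linarith)

lemma Bd_disj (c : Cyl) (J : Finset ℕ) (h : ℕ → Dy) (θ : ℕ → ℝ) (hθ : ∀ j, |θ j| ≤ 1)
    (hs : ∀ j ∈ J, Supp (c.sub j) (h j)) (hb : ∀ j ∈ J, Bd (h j) 1) :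
    Bd (∑ j ∈ J, θ j • h j) 1 := by
  intro z
  rw [Dy.sum_apply]
  by_cases hz : ∃ j ∈ J, (c.sub j).mem z
  · obtain ⟨j, hj, hjz⟩ := hz
    rw [Finset.sum_eq_single_of_mem j hj, Dy.smul_apply, abs_mul]
    · have := mul_le_mul (hθ j) (hb j hj z) (abs_nonneg _) zero_le_one
      linarith
    · intro k hk hkj
      rw [Dy.smul_apply, hs k hk z (Cyl.sub_disj c hkj.symm hjz), mul_zero]
  · push Not at hz
    rw [Finset.sum_eq_zero fun j hj => by rw [Dy.smul_apply, hs j hj z (hz j hj), mul_zero]]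
    simp

def Bad (T : Dy →ₗ[ℝ] (El Δ → ℝ)) (ε : ℝ) (c : Cyl) (e : El Δ) : Prop :=
  ∃ h, Supp c h ∧ Bd h 1 ∧ ε < |T h e|

theorem step_d1 {T : Dy →ₗ[ℝ] (El Δ → ℝ)} {M : ℝ} (hT : Good T M) (ε : ℝ) (k : ℕ)
    (hk : M < k * ε) (c : Cyl) : ∃ c1 : Cyl, c1.le c ∧
      ¬ ∃ F : ℕ → El Δ, Fam (Finset.range k) F ∧ ∀ i ∈ Finset.range k, Bad T ε c1 (F i) := by
  by_contra hcon
  push Not at hcon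
  choose F hF hbad using fun i => hcon (c.sub i) (Cyl.sub_le _ _)
  obtain ⟨g, hg1, hg2⟩ := selection k (Finset.range k) (fun _ => Finset.range k) F (by simp)
    (by simp) (fun i _ => hF i)
  have hb : ∀ i, ∃ h, i ∈ Finset.range k → (Supp (c.sub i) h ∧ Bd h 1 ∧ ε < |T h (F i (g i))|) := by
    intro i
    by_cases hi : i ∈ Finset.range k
    · obtain ⟨h, hh⟩ := hbad i (g i) (hg1 i hi)
      exact ⟨h, fun _ => hh⟩
    · exact ⟨0, fun h => absurd h hi⟩
  choose h hh using hb
  obtain ⟨θ, hθ, hle⟩ := sign_lemma (fun i j => T (h j) (F i (g i))) (Finset.range k)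
  have hBd := Bd_disj c (Finset.range k) h θ (fun j => (hθ j).le) (fun j hj => (hh j hj).1)
    (fun j hj => (hh j hj).2.1)
  set f := ∑ j ∈ Finset.range k, θ j • h j with hf
  have hTf : ∀ e, T f e = ∑ j ∈ Finset.range k, θ j * T (h j) e := fun e => by
    simp [hf, map_sum, Finset.sum_apply]
  let F' : ℕ → El Δ := fun i => if 0 ≤ T f (F i (g i)) then F i (g i) else (F i (g i)).neg
  have hF'T : ∀ i, T f (F' i) = |T f (F i (g i))| := by
    intro i
    simp only [F']
    split_ifs with h0
    · rw [abs_of_nonneg h0]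
    · rw [hT.neg, abs_of_neg (not_le.1 h0)]
  have hF'β : ∀ i, (F' i).β = (F i (g i)).β ∧ (F' i).a = (F i (g i)).a := by
    intro i
    simp only [F']
    split_ifs <;> exact ⟨rfl, rfl⟩
  have hFam : Fam (Finset.range k) F' := by
    intro i hi j hj hij
    obtain ⟨p, h1, h2, h3⟩ := hg2 i hi j hj hij
    refine ⟨p, ?_, ?_, ?_⟩
    · rw [(hF'β i).2]; exact h1
    · rw [(hF'β j).2]; exact h2
    · rw [(hF'β i).1, (hF'β j).1]; exact h3
  have h1 := (le_abs_self _).trans (hT.bd f 1 hBd _ F' hFam)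
  simp only [hF'T] at h1
  have h2 : k * ε ≤ ∑ i ∈ Finset.range k, |T (h i) (F i (g i))| := by
    calc k * ε = ∑ i ∈ Finset.range k, ε := by simp
      _ ≤ _ := Finset.sum_le_sum fun i hi => (hh i hi).2.2.le
  simp only [hTf] at h1
  linarith

lemma chain_branch (C : Set (El Δ)) (hne : C.Nonempty) (hC : ∀ e ∈ C, ∀ e' ∈ C, ¬ Incomp e e') :
    ∃ γ ∈ Δ.B, ∀ e ∈ C, ∀ p < e.a, e.β p = γ p := by
  have hag : ∀ e ∈ C, ∀ e' ∈ C, ∀ p, p < e.a → p < e'.a → e.β p = e'.β p := by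
    intro e he e' he' p h1 h2
    by_contra h
    exact hC e he e' he' ⟨p, h1, h2, h⟩
  by_cases hb : ∀ n, ∃ e ∈ C, n < e.a
  · choose e he hea using hb
    refine ⟨fun n => (e n).β n, Δ.closed _ fun n => ?_, fun e' he' p hp => ?_⟩
    · exact ⟨(e n).β, (e n).hβ, fun i hi => hag _ (he n) _ (he i) i (hi.trans (hea n)) (hea i)⟩
    · exact hag _ he' _ (he p) p hp (hea p)
  · push Not at hb
    obtain ⟨n, hn⟩ := hb
    have hfin : (El.a '' C).Finite := (Set.finite_Iic n).subset (by
      rintro _ ⟨e, he, rfl⟩; exact hn e he)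
    obtain ⟨_, ⟨e, he, rfl⟩, hmax⟩ := hfin.exists_maximal (hne.image _)
    refine ⟨e.β, e.hβ, fun e' he' p hp => hag _ he' _ he p hp (hp.trans_le ?_)⟩
    by_contra h
    push Not at h
    exact absurd (hmax ⟨e', he', rfl⟩ h.le) (not_le.2 h)

theorem step_d2 (P : El Δ → Prop) (k : ℕ)
    (hk : ¬ ∃ F : ℕ → El Δ, Fam (Finset.range k) F ∧ ∀ i ∈ Finset.range k, P (F i)) :
    ∃ l : List (ℕ → Δ.A), (∀ γ ∈ l, γ ∈ Δ.B) ∧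
      ∀ e, P e → ∃ γ ∈ l, ∀ p < e.a, e.β p = γ p := by
  classical
  by_cases hne : ∃ e, P e
  swap
  · exact ⟨[], by simp, fun e he => absurd ⟨e, he⟩ hne⟩
  obtain ⟨e0, he0⟩ := hne
  obtain ⟨m, ⟨F, hF, hP⟩, hm⟩ : ∃ m, (∃ F : ℕ → El Δ, Fam (Finset.range m) F ∧
      ∀ i ∈ Finset.range m, P (F i)) ∧ ¬ (∃ F : ℕ → El Δ, Fam (Finset.range (m+1)) F ∧
      ∀ i ∈ Finset.range (m+1), P (F i)) := by
    by_contra hcon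
    push Not at hcon
    apply hk
    clear hk
    induction k with
    | zero => exact ⟨fun _ => e0, by intro i hi; simp at hi, by simp⟩
    | succ k ih => exact hcon k ih
  have hext : ∀ (G : ℕ → El Δ) (e : El Δ), Fam (Finset.range m) G → (∀ i ∈ Finset.range m, P (G i)) →
      P e → ∃ i ∈ Finset.range m, ¬ Incomp e (G i) := by
    intro G e hG hPG he
    by_contra hcon
    push Not at hcon
    apply hm
    refine ⟨fun i => if i = m then e else G i, ?_, ?_⟩
    · intro i hi j hj hij
      simp only [Finset.mem_range] at hi hj hcon
      by_cases h1 : i = m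
      · by_cases h2 : j = m
        · omega
        · simp only [if_pos h1, if_neg h2]
          exact hcon j (by omega)
      · by_cases h2 : j = m
        · simp only [if_neg h1, if_pos h2]
          exact (hcon i (by omega)).symm
        · simp only [if_neg h1, if_neg h2]
          exact hG i (Finset.mem_range.2 (by omega)) j (Finset.mem_range.2 (by omega)) hij
    · intro i hi
      by_cases h1 : i = m
      · simpa [h1] using he
      · simp only [if_neg h1]
        exact hPG i (Finset.mem_range.2 (by have := Finset.mem_range.1 hi; omega))
  have hself : ∀ e : El Δ, ¬ Incomp e e := fun e ⟨p, _, _, h⟩ => h rfl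
  have hchain : ∀ i ∈ Finset.range m, ∃ γ ∈ Δ.B, ∀ e ∈ {e | P e ∧ ¬ Incomp e (F i)},
      ∀ p < e.a, e.β p = γ p := by
    intro i hi
    refine chain_branch _ ⟨F i, hP i hi, hself _⟩ ?_
    rintro e ⟨he, hei⟩ e' ⟨he', hei'⟩ hinc
    have ag : ∀ p, p < e.a → p < (F i).a → e.β p = (F i).β p := fun p h1 h2 => by
      by_contra h; exact hei ⟨p, h1, h2, h⟩
    have ag' : ∀ p, p < e'.a → p < (F i).a → e'.β p = (F i).β p := fun p h1 h2 => by
      by_contra h; exact hei' ⟨p, h1, h2, h⟩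
    obtain ⟨p, hp1, hp2, hp3⟩ := hinc
    by_cases hpF : p < (F i).a
    · exact hp3 ((ag p hp1 hpF).trans (ag' p hp2 hpF).symm)
    · push Not at hpF
      have hinc : ∀ j ∈ Finset.range m, j ≠ i → Incomp e (F j) ∧ Incomp e' (F j) := by
        intro j hj hji
        obtain ⟨t, ht1, ht2, ht3⟩ := hF i hi j hj hji.symm
        exact ⟨⟨t, by omega, ht2, by rw [ag t (by omega) ht1]; exact ht3⟩,
          ⟨t, by omega, ht2, by rw [ag' t (by omega) ht1]; exact ht3⟩⟩
      obtain ⟨j, hj, hj2⟩ := hext (Function.update F i e) e' (by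
        intro s hs t ht hst
        by_cases h1 : s = i
        · subst h1
          simp only [Function.update_self, Function.update_of_ne hst.symm]
          exact (hinc t ht hst.symm).1
        · by_cases h2 : t = i
          · subst h2
            simp only [Function.update_self, Function.update_of_ne hst]
            exact (hinc s hs hst).1.symm
          · simp only [Function.update_of_ne h1, Function.update_of_ne h2]
            exact hF s hs t ht hst) (by
        intro s hs
        by_cases h1 : s = i
        · subst h1; simpa using he
        · rw [Function.update_of_ne h1]; exact hP s hs) he'
      apply hj2
      by_cases h1 : j = i
      · subst h1
        rw [Function.update_self]
        exact ⟨p, hp2, hp1, hp3.symm⟩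
      · rw [Function.update_of_ne h1]
        exact (hinc j hj h1).2
  haveI : Nonempty (ℕ → Δ.A) := ⟨e0.β⟩
  choose! γ hγB hγ using hchain
  refine ⟨(List.range m).map γ, ?_, ?_⟩
  · intro x hx
    obtain ⟨i, hi, rfl⟩ := List.mem_map.1 hx
    exact hγB i (Finset.mem_range.2 (List.mem_range.1 hi))
  · intro e he
    obtain ⟨i, hi, hi2⟩ := hext F e hF hP he
    exact ⟨γ i, List.mem_map.2 ⟨i, List.mem_range.2 (Finset.mem_range.1 hi), rfl⟩,
      hγ i hi e ⟨he, hi2⟩⟩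

def El.swap (e : El Δ) (γ : ℕ → Δ.A) (hγ : γ ∈ Δ.B) (b : ℕ) (h : ∀ p, p + 1 < b → e.β p = γ p)
    (a : ℕ) : El Δ :=
  { β := γ, hβ := hγ, a := a, φ := e.φ, hφ := e.hφ
    ψ := fun k => if k < b then e.ψ k else e.φ
    hψ := fun k => by
      split_ifs
      · exact e.hψ k
      · exact e.hφ
    comp := fun k i hik => by
      split_ifs with hk
      · rw [← h i (by omega)]; exact e.comp k i hik
      · rfl }

lemma ev_swap (e : El Δ) (γ : ℕ → Δ.A) (hγ : γ ∈ Δ.B) (b : ℕ) (h : ∀ p, p + 1 < b → e.β p = γ p)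
    (hb : e.a ≤ b) (v : Δ.VV) (hv : v ∈ Adm Δ) :
    ev e v = ev (e.at b) v + ev (e.swap γ hγ b h e.a) v - ev (e.swap γ hγ b h b) v := by
  classical
  simp only [ev_apply, Finsupp.sum]
  rw [← Finset.sum_add_distrib, ← Finset.sum_sub_distrib]
  refine Finset.sum_congr rfl fun q hq => ?_
  have hq2 : q.2 ≤ q.1.length := by
    rcases (hv q).2 (Finsupp.mem_support_iff.1 hq) with h | h <;> omega
  by_cases hlen : q.1.length < b
  · have h1 : res γ q.1.length = res e.β q.1.length := res_eq.2 fun i hi => (h i (by omega)).symm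
    have h2 : InT (e.swap γ hγ b h e.a) q.1 ↔ InT e q.1 := by
      change q.1 = res γ q.1.length ∧ _ ↔ q.1 = res e.β q.1.length ∧ _
      rw [h1]; exact Iff.rfl
    have h3 : ¬ InT (e.at b) q.1 := fun h => absurd h.2 (not_le.2 hlen)
    have h4 : ¬ InT (e.swap γ hγ b h b) q.1 := fun h => absurd h.2 (not_le.2 hlen)
    have h5 : (e.swap γ hγ b h e.a).ψ q.2 = e.ψ q.2 := if_pos (by omega)
    rw [if_neg h3, if_neg h4, h5]
    simp only [h2]
    ring
  · push Not at hlen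
    have h2 : InT (e.swap γ hγ b h e.a) q.1 ↔ InT (e.swap γ hγ b h b) q.1 :=
      and_congr_right fun _ => ⟨fun _ => hlen, fun _ => hb.trans hlen⟩
    have h3 : InT (e.at b) q.1 ↔ InT e q.1 :=
      and_congr_right fun _ => ⟨fun _ => hb.trans hlen, fun _ => hlen⟩
    simp only [h2, h3]
    have h4 : (e.at b).ψ = e.ψ := rfl
    have h5 : (e.swap γ hγ b h e.a).ψ = (e.swap γ hγ b h b).ψ := rfl
    rw [h4, h5]; ring

lemma agree_list (β : ℕ → Δ.A) (l : List (ℕ → Δ.A)) (a : ℕ)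
    (h : ∀ b, a ≤ b → ∃ γ ∈ l, ∀ p < b, β p = γ p) : β ∈ l := by
  classical
  by_contra hcon
  have h1 : ∀ γ ∈ l, ∃ p, β p ≠ γ p := fun γ hγ => by
    by_contra h2; push Not at h2
    exact hcon ((funext h2 : β = γ) ▸ hγ)
  choose! p hp using h1
  obtain ⟨γ, hγ, hag⟩ := h (max a (l.toFinset.sup p + 1)) (le_max_left _ _)
  have := Finset.le_sup (f := p) (List.mem_toFinset.2 hγ)
  exact hp γ hγ (hag _ (lt_max_of_lt_right (Nat.lt_succ_of_le this)))

theorem step_d {T : Dy →ₗ[ℝ] (El Δ → ℝ)} {M : ℝ} (hT : Good T M) : Sm T Set.univ := by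
  classical
  intro c ε hε
  have hε' : 0 < ε / 3 := by positivity
  obtain ⟨k, hk⟩ := exists_nat_gt (M / (ε / 3))
  rw [div_lt_iff₀ hε'] at hk
  obtain ⟨c1, hc1, hno⟩ := step_d1 hT (ε / 3) k hk c
  obtain ⟨l, hl, hbad⟩ := step_d2 (Bad T (ε / 3) c1) k hno
  obtain ⟨h, hH, hh⟩ := step_c l hl hT c1 (ε / 3) hε'
  refine ⟨h, hH.mono hc1, fun e _ => ?_⟩
  have hnb : ∀ e, ¬ Bad T (ε / 3) c1 e → |T h e| ≤ ε / 3 := fun e he => by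
    by_contra hcon
    exact he ⟨h, hH.supp, hH.bd, not_le.1 hcon⟩
  by_cases hall : ∀ b, e.a ≤ b → Bad T (ε / 3) c1 (e.at b)
  · have : e.β ∈ l := agree_list e.β l e.a fun b hb => hbad _ (hall b hb)
    have := hh e this
    linarith
  · push Not at hall
    have hb := Nat.find_spec hall
    have hmin := fun {m} => Nat.find_min (m := m) hall
    set b := Nat.find hall with hbdef
    by_cases hba : b = e.a
    · have h1 := hnb _ hb.2
      rw [hba] at h1
      have h2 : |T h e| ≤ ε / 3 := h1
      linarith
    · have hb1 : e.a ≤ b - 1 := by have := hb.1; omega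
      have hbm := hmin (m := b - 1) (by omega)
      push Not at hbm
      obtain ⟨γ, hγl, hγ⟩ := hbad _ (hbm hb1)
      have hag : ∀ p, p + 1 < b → e.β p = γ p := fun p hp => hγ p (by
        change p < b - 1; omega)
      have hrel := hT.rel ![1, -1, -1, 1] ![e, e.at b, e.swap γ (hl γ hγl) b hag e.a,
        e.swap γ (hl γ hγl) b hag b] (fun v hv => by
          simp only [Fin.sum_univ_four]
          have := ev_swap e γ (hl γ hγl) b hag hb.1 v hv
          simp
          linarith) h
      simp only [Fin.sum_univ_four] at hrel
      simp at hrel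
      have h1 := abs_le.1 (hnb _ hb.2)
      have h2 := abs_le.1 (hh (e.swap γ (hl γ hγl) b hag e.a) hγl)
      have h3 := abs_le.1 (hh (e.swap γ (hl γ hγl) b hag b) hγl)
      rw [abs_le]
      constructor <;> linarith [h1.1, h1.2, h2.1, h2.2, h3.1, h3.2]

end
end NUB


namespace NUB
noncomputable section

variable {Δ : Dat}

lemma neg_pow_cases (j : ℕ) : (-1 : ℝ) ^ j = 1 ∨ (-1 : ℝ) ^ j = -1 := neg_one_pow_eq_or ℝ j

lemma Fam.subset {I J : Finset ℕ} {F : ℕ → El Δ} (h : Fam I F) (hJ : J ⊆ I) : Fam J F :=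
  fun i hi j hj => h i (hJ hi) j (hJ hj)

theorem step_e {T : Dy →ₗ[ℝ] (El Δ → ℝ)} {M : ℝ} (hT : Good T M) (c0 : ℝ) (hc0 : 0 < c0)
    (hlow : ∀ f z, ∃ I F, Fam I F ∧ c0 * |f.1 z| ≤ |∑ i ∈ I, T f (F i)|) : False := by
  classical
  have hη : 0 < c0 / 8 := by positivity
  let R : Finset (List Δ.A) → Dy → Δ.VV → Finset (List Δ.A) → Prop := fun S h v S' =>
    S ⊆ S' ∧ (∀ q ∈ v.support, q.1 ∈ S') ∧
    (∀ I F, Fam I F → |∑ i ∈ I, (T h (F i) - ev (F i) v)| ≤ c0 / 8) ∧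
    ∀ e, |T h e| ≤ c0 / 8 / (S.card + 1)
  obtain ⟨h, v, S, -, hR, hH, hone, hBd⟩ := seq_trick R Cyl.top ∅ (by
    intro c' hc' S
    have hle : c0 / 8 / (S.card + 1) ≤ c0 / 8 := div_le_self hη.le (by
      have : (0 : ℝ) ≤ S.card := Nat.cast_nonneg _
      linarith)
    obtain ⟨h, v, hv, hH, hsm, hF, -⟩ := FC hT (step_d hT) ∅ c' (c0 / 8 / (S.card + 1))
      (by positivity)
    exact ⟨h, v, S ∪ v.support.image Prod.fst, hH, Finset.subset_union_left,
      fun q hq => Finset.mem_union_right _ (Finset.mem_image_of_mem _ hq),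
      fun I F hIF => (hF I F hIF).trans hle, fun e => hsm e trivial⟩)
  have hmono : ∀ i j, i ≤ j → S i ⊆ S j := by
    intro i j hij
    induction j, hij using Nat.le_induction with
    | base => exact subset_rfl
    | succ j _ ih => exact ih.trans (hR j).1
  obtain ⟨N, hN⟩ := exists_nat_gt (M * 2 / (c0 / 2))
  rw [div_lt_iff₀ (by positivity)] at hN
  obtain ⟨z, hz⟩ := hone N
  obtain ⟨I, F, hF, hIF⟩ := hlow (∑ j ∈ Finset.range N, h j) z
  rw [hz, abs_of_nonneg (Nat.cast_nonneg N)] at hIF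
  let meets : ℕ → ℕ → Prop := fun i k => ∃ q ∈ (v k).support, InT (F i) q.1
  let jf : ℕ → ℕ := fun i => if hx : ∃ k, meets i k then Nat.find hx else 0
  let σ : ℕ → ℝ := fun i => (-1 : ℝ) ^ jf i
  have hj : ∀ j, |∑ i ∈ I, (1 - σ i * (-1) ^ j) * T (h j) (F i)| ≤ c0 / 2 := by
    intro j
    obtain ⟨-, h1, h2, h3⟩ := hR j
    let I' := I.filter fun i => ¬ (1 - σ i * (-1) ^ j = 0)
    let A := I'.filter fun i => ∃ s ∈ S j, InT (F i) s
    let B := I'.filter fun i => ¬ ∃ s ∈ S j, InT (F i) s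
    have hA : |∑ i ∈ A, T (h j) (F i)| ≤ c0 / 8 := by
      have hcard : A.card ≤ (S j).card := by
        have hx : ∀ i ∈ A, ∃ s ∈ S j, InT (F i) s := fun i hi => (Finset.mem_filter.1 hi).2
        choose! s hs1 hs2 using hx
        refine Finset.card_le_card_of_injOn s hs1 fun i hi k hk hik => ?_
        refine hF.disj (Finset.mem_of_mem_filter _ (Finset.mem_of_mem_filter _ hi))
          (Finset.mem_of_mem_filter _ (Finset.mem_of_mem_filter _ hk)) (hs2 i hi) ?_
        rw [hik]; exact hs2 k hk
      have hcard' : (A.card : ℝ) ≤ (S j).card := Nat.cast_le.2 hcard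
      calc |∑ i ∈ A, T (h j) (F i)| ≤ ∑ i ∈ A, |T (h j) (F i)| := Finset.abs_sum_le_sum_abs _ _
        _ ≤ ∑ i ∈ A, c0 / 8 / ((S j).card + 1) := Finset.sum_le_sum fun i _ => h3 _
        _ = A.card * (c0 / 8 / ((S j).card + 1)) := by simp
        _ ≤ ((S j).card + 1) * (c0 / 8 / ((S j).card + 1)) := by gcongr; linarith
        _ = c0 / 8 := by field_simp
    have hB : |∑ i ∈ B, T (h j) (F i)| ≤ c0 / 8 := by
      have h4 := h2 B F (hF.subset ((Finset.filter_subset _ _).trans (Finset.filter_subset _ _)))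
      rw [Finset.sum_congr rfl (g := fun i => T (h j) (F i))] at h4
      · exact h4
      · intro i hi
        obtain ⟨hi1, hi2⟩ := Finset.mem_filter.1 hi
        obtain ⟨-, hi3⟩ := Finset.mem_filter.1 hi1
        have hnm : ¬ meets i j := by
          intro hm
          apply hi3
          have hx : ∃ k, meets i k := ⟨j, hm⟩
          have hjf : jf i = j := by
            simp only [jf]
            rw [dif_pos hx, Nat.find_eq_iff]
            refine ⟨hm, fun k hk hmk => ?_⟩
            obtain ⟨q, hq, hqi⟩ := hmk
            exact hi2 ⟨q.1, hmono _ _ hk ((hR k).2.1 q hq), hqi⟩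
          simp only [σ]
          rw [hjf, ← mul_pow]
          simp
        have : ev (F i) (v j) = 0 := by
          rw [ev_apply]
          exact Finset.sum_eq_zero fun q hq => if_neg fun hh => hnm ⟨q, hq, hh⟩
        rw [this, sub_zero]
    have hsum : ∑ i ∈ I, (1 - σ i * (-1) ^ j) * T (h j) (F i) =
        2 * (∑ i ∈ A, T (h j) (F i) + ∑ i ∈ B, T (h j) (F i)) := by
      rw [Finset.sum_filter_add_sum_filter_not, Finset.mul_sum, Finset.sum_filter]
      refine Finset.sum_congr rfl fun i _ => ?_
      by_cases h5 : 1 - σ i * (-1) ^ j = 0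
      · rw [if_neg (not_not.2 h5), h5, zero_mul]
      · rw [if_pos h5]
        congr 1
        simp only [σ] at h5 ⊢
        rcases neg_pow_cases (jf i) with h6 | h6 <;> rcases neg_pow_cases j with h7 | h7 <;>
          rw [h6, h7] at h5 ⊢ <;> revert h5 <;> norm_num
    rw [hsum, abs_mul, abs_two]
    have := abs_add_le (∑ i ∈ A, T (h j) (F i)) (∑ i ∈ B, T (h j) (F i))
    linarith
  let F' : ℕ → El Δ := fun i => if σ i = 1 then F i else (F i).neg
  have hF'T : ∀ f i, T f (F' i) = σ i * T f (F i) := by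
    intro f i
    simp only [F']
    split_ifs with h0
    · rw [h0, one_mul]
    · rw [hT.neg]
      rcases neg_pow_cases (jf i) with h6 | h6
      · exact absurd h6 h0
      · simp only [σ]; rw [h6]; ring
  have hF'β : ∀ i, (F' i).β = (F i).β ∧ (F' i).a = (F i).a := by
    intro i
    simp only [F']
    split_ifs <;> exact ⟨rfl, rfl⟩
  have hFam : Fam I F' := by
    intro i hi j hj hij
    obtain ⟨p, h1, h2, h3⟩ := hF i hi j hj hij
    refine ⟨p, ?_, ?_, ?_⟩
    · rw [(hF'β i).2]; exact h1
    · rw [(hF'β j).2]; exact h2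
    · rw [(hF'β i).1, (hF'β j).1]; exact h3
  have h1 := hT.bd _ 2 (hBd N) I F' hFam
  have h2 : ∑ i ∈ I, T (∑ j ∈ Finset.range N, h j) (F i) -
      ∑ i ∈ I, T (∑ j ∈ Finset.range N, (-1 : ℝ) ^ j • h j) (F' i) =
      ∑ j ∈ Finset.range N, ∑ i ∈ I, (1 - σ i * (-1) ^ j) * T (h j) (F i) := by
    rw [Finset.sum_comm, ← Finset.sum_sub_distrib]
    refine Finset.sum_congr rfl fun i _ => ?_
    rw [hF'T]
    simp only [map_sum, map_smul, Finset.sum_apply, Pi.smul_apply, smul_eq_mul]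
    rw [Finset.mul_sum, ← Finset.sum_sub_distrib]
    exact Finset.sum_congr rfl fun j _ => by ring
  have h3 : |∑ j ∈ Finset.range N, ∑ i ∈ I, (1 - σ i * (-1) ^ j) * T (h j) (F i)| ≤ N * (c0 / 2) := by
    calc _ ≤ ∑ j ∈ Finset.range N, |∑ i ∈ I, (1 - σ i * (-1) ^ j) * T (h j) (F i)| :=
          Finset.abs_sum_le_sum_abs _ _
      _ ≤ ∑ j ∈ Finset.range N, c0 / 2 := Finset.sum_le_sum fun j _ => hj j
      _ = _ := by simp
  rw [← h2] at h3
  have h4 := abs_sub_abs_le_abs_sub (∑ i ∈ I, T (∑ j ∈ Finset.range N, h j) (F i))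
    (∑ i ∈ I, T (∑ j ∈ Finset.range N, (-1 : ℝ) ^ j • h j) (F' i))
  linarith

end
end NUB


namespace NUB
noncomputable section

lemma Embeds.comp {X Y Z : Type*} [SeminormedAddCommGroup X] [NormedSpace ℝ X]
    [SeminormedAddCommGroup Y] [NormedSpace ℝ Y] [SeminormedAddCommGroup Z] [NormedSpace ℝ Z]
    (h1 : Embeds X Y) (h2 : Embeds Y Z) : Embeds X Z := by
  obtain ⟨S, c, hc, hS⟩ := h1
  obtain ⟨T, d, hd, hT⟩ := h2
  refine ⟨T.comp S, d * c, mul_pos hd hc, fun x => ?_⟩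
  calc d * c * ‖x‖ = d * (c * ‖x‖) := by ring
    _ ≤ d * ‖S x‖ := by gcongr; exact hS x
    _ ≤ _ := hT _

lemma Embeds.of_isometry {X Y : Type*} [SeminormedAddCommGroup X] [NormedSpace ℝ X]
    [SeminormedAddCommGroup Y] [NormedSpace ℝ Y] (f : X →ₗᵢ[ℝ] Y) : Embeds X Y :=
  ⟨f.toContinuousLinearMap, 1, one_pos, fun x => by simp⟩

/-- Banach–Mazur: separable normed spaces embed isometrically in `C(2^ℕ)`. -/
theorem banach_mazur (E : Type*) [NormedAddCommGroup E] [NormedSpace ℝ E]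
    [TopologicalSpace.SeparableSpace E] : Nonempty (E →ₗᵢ[ℝ] CantorC) := by
  let K : Set (WeakDual ℝ E) := WeakDual.toStrongDual ⁻¹' Metric.closedBall 0 1
  have hK : IsCompact K := WeakDual.isCompact_closedBall 0 1
  have : CompactSpace K := isCompact_iff_compactSpace.1 hK
  have : TopologicalSpace.MetrizableSpace K := WeakDual.metrizable_of_isCompact ℝ E K hK
  let : MetricSpace K := TopologicalSpace.metrizableSpaceMetric K
  have : Nonempty K := ⟨⟨0, by simp [K]⟩⟩
  obtain ⟨π, hπ, hs⟩ := exists_nat_bool_continuous_surjective_of_compact K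
  have hle : ∀ (k : K) (y : E), |(k.1 : WeakDual ℝ E) y| ≤ ‖y‖ := by
    intro k y
    have h := k.2
    simp only [K, Set.mem_preimage, mem_closedBall_zero_iff] at h
    have := (WeakDual.toStrongDual k.1).le_of_opNorm_le h y
    simpa using this
  let L : E →ₗ[ℝ] CantorC :=
    { toFun := fun y => ⟨fun x => (π x).1 y, (WeakDual.eval_continuous y).comp
          (continuous_subtype_val.comp hπ)⟩
      map_add' := fun y z => by ext x; simp
      map_smul' := fun r y => by ext x; simp }
  refine ⟨⟨L, fun y => le_antisymm ?_ ?_⟩⟩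
  · exact ((L y).norm_le (norm_nonneg _)).2 fun x => hle (π x) y
  · obtain ⟨g, hg, hx⟩ := exists_dual_vector'' ℝ y
    obtain ⟨z, hz⟩ := hs ⟨StrongDual.toWeakDual g, by simpa [K] using hg⟩
    have h1 := (L y).norm_coe_le_norm z
    have h2 : L y z = ‖y‖ := by
      change (π z).1 y = _
      rw [hz]; exact_mod_cast hx
    rw [h2] at h1
    simpa using h1

theorem toSB (E : Type*) [NormedAddCommGroup E] [NormedSpace ℝ E] [CompleteSpace E]
    [TopologicalSpace.SeparableSpace E] : ∃ Y : SB, Embeds E Y.1 ∧ Embeds Y.1 E := by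
  obtain ⟨L⟩ := banach_mazur E
  refine ⟨⟨LinearMap.range L.toLinearMap, ?_⟩, ?_, ?_⟩
  · exact L.isometry.isClosedEmbedding.isClosed_range
  · exact Embeds.of_isometry L.equivRange.toLinearIsometry
  · exact Embeds.of_isometry L.equivRange.symm.toLinearIsometry

lemma embed_closure {E Y : Type*} [NormedAddCommGroup E] [NormedSpace ℝ E]
    [NormedAddCommGroup Y] [NormedSpace ℝ Y] [CompleteSpace Y] (X : Submodule ℝ E)
    (S : X →ₗ[ℝ] Y) (K c : ℝ) (hc : 0 < c) (hK : ∀ x, ‖S x‖ ≤ K * ‖x‖) (hl : ∀ x, c * ‖x‖ ≤ ‖S x‖) :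
    Embeds X.topologicalClosure Y := by
  let i : X →ₗ[ℝ] X.topologicalClosure := Submodule.inclusion X.le_topologicalClosure
  have hi : DenseRange i := by
    exact (denseRange_inclusion_iff (s := (X : Set E)) (t := (X.topologicalClosure : Set E))
      X.le_topologicalClosure).2 (by rw [Submodule.topologicalClosure_coe])
  have hC : ∃ C, ∀ f, ‖S f‖ ≤ C * ‖i f‖ := ⟨K, hK⟩
  have key := LinearMap.extendOfNorm_eq (f := S) hi hC
  refine ⟨S.extendOfNorm i, c, hc, fun x => ?_⟩
  refine hi.induction (P := fun x => c * ‖x‖ ≤ ‖S.extendOfNorm i x‖) ?_ ?_ x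
  · rintro _ ⟨f, rfl⟩
    rw [key f]; exact hl f
  · exact isClosed_le (by fun_prop) (by fun_prop)

end
end NUB


namespace NUB
noncomputable section

variable {Δ : Dat}

lemma amo_sum {I : Finset ℕ} {x : ℕ → ℝ} {c : ℝ} (hc : 0 ≤ c) (h1 : ∀ i ∈ I, |x i| ≤ c)
    (h2 : ∀ i ∈ I, ∀ j ∈ I, x i ≠ 0 → x j ≠ 0 → i = j) : |∑ i ∈ I, x i| ≤ c := by
  by_cases h : ∃ i ∈ I, x i ≠ 0
  · obtain ⟨i, hi, hxi⟩ := h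
    rw [Finset.sum_eq_single_of_mem i hi]
    · exact h1 i hi
    · intro j hj hij
      by_contra hne
      exact hij (h2 j hj i hi hne hxi)
  · push Not at h
    rw [Finset.sum_eq_zero h]; simpa using hc

open Classical in
lemma ev_sum_bd {I : Finset ℕ} {F : ℕ → El Δ} (h : Fam I F) (v : Δ.VV) :
    |∑ i ∈ I, ev (F i) v| ≤ v.sum fun _ z => ‖z‖ := by
  simp only [ev_apply, Finsupp.sum]
  rw [Finset.sum_comm]
  refine (Finset.abs_sum_le_sum_abs _ _).trans (Finset.sum_le_sum fun q _ => ?_)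
  refine amo_sum (norm_nonneg _) (fun i _ => ?_) (fun i hi j hj h1 h2 => ?_)
  · split_ifs
    · exact (F i).hψ _ _
    · simp
  · by_cases h1' : InT (F i) q.1
    · by_cases h2' : InT (F j) q.1
      · exact h.disj hi hj h1' h2'
      · simp [h2'] at h2
    · simp [h1'] at h1

abbrev FF (Δ : Dat) := {p : Finset ℕ × (ℕ → El Δ) // Fam p.1 p.2}

abbrev WW (Δ : Dat) := lp (fun _ : FF Δ => ℝ) ⊤

def Lam (Δ : Dat) : Δ.VV →ₗ[ℝ] WW Δ where
  toFun v := ⟨fun p => ∑ i ∈ p.1.1, ev (p.1.2 i) v, memℓp_infty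
    ⟨v.sum fun _ z => ‖z‖, by rintro _ ⟨p, rfl⟩; exact ev_sum_bd p.2 v⟩⟩
  map_add' v w := by
    ext p; simp [Finset.sum_add_distrib]; rfl
  map_smul' r v := by
    ext p; simp [Finset.mul_sum]

lemma Lam_apply (v : Δ.VV) (p : FF Δ) : Lam Δ v p = ∑ i ∈ p.1.1, ev (p.1.2 i) v := rfl

lemma norm_Lam_le {v : Δ.VV} {c : ℝ} (hc : 0 ≤ c)
    (h : ∀ I F, Fam I F → |∑ i ∈ I, ev (F i) v| ≤ c) : ‖Lam Δ v‖ ≤ c :=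
  lp.norm_le_of_forall_le hc fun p => h _ _ p.2

def YY (Δ : Dat) : Submodule ℝ (WW Δ) := ((Adm Δ).map (Lam Δ)).topologicalClosure

instance : CompleteSpace (YY Δ) :=
  (Submodule.isClosed_topologicalClosure _).completeSpace_coe

lemma norm_Lam_single (q : List Δ.A × ℕ) (z : CantorC) :
    ‖Lam Δ (Finsupp.single q z)‖ ≤ ‖z‖ := by
  refine norm_Lam_le (norm_nonneg _) fun I F h => (ev_sum_bd h _).trans ?_
  rw [Finsupp.sum_single_index]; simp

lemma YY_sep : TopologicalSpace.IsSeparable (YY Δ : Set (WW Δ)) := by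
  have := Δ.cnt
  have : TopologicalSpace.SeparableSpace CantorC := inferInstance
  let S : Set (WW Δ) := ⋃ q : List Δ.A × ℕ, Set.range fun z => Lam Δ (Finsupp.single q z)
  have hS : TopologicalSpace.IsSeparable S := by
    refine TopologicalSpace.IsSeparable.iUnion fun q => TopologicalSpace.isSeparable_range ?_
    exact AddMonoidHomClass.continuous_of_bound
      ((Lam Δ).comp (Finsupp.lsingle (R := ℝ) (M := CantorC) q)) 1 fun z => by
        rw [one_mul]; exact norm_Lam_single q z
  have h2 := (hS.span (R := ℝ)).closure
  refine h2.mono ?_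
  rw [YY, Submodule.topologicalClosure_coe]
  refine closure_mono ?_
  rintro _ ⟨v, -, rfl⟩
  rw [← Finsupp.sum_single v, Finsupp.sum, map_sum]
  refine Submodule.sum_mem _ fun q _ => Submodule.subset_span ?_
  exact Set.mem_iUnion.2 ⟨q, _, rfl⟩

lemma YY_apply (y : YY Δ) (p : FF Δ) :
    (y.1 : WW Δ) p = ∑ i ∈ p.1.1, (y.1 : WW Δ) ⟨({0}, fun _ => p.1.2 i), Fam.single _⟩ := by
  have hcont : ∀ p : FF Δ, Continuous fun w : WW Δ => w p := fun p =>
    (lp.evalCLM ℝ (fun _ : FF Δ => ℝ) ⊤ p).continuous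
  have hcl : IsClosed {w : WW Δ | w p = ∑ i ∈ p.1.1, w ⟨({0}, fun _ => p.1.2 i), Fam.single _⟩} :=
    isClosed_eq (hcont p) (continuous_finsetSum _ fun i _ => hcont _)
  have : (YY Δ : Set (WW Δ)) ⊆ _ := closure_minimal (s := ((Adm Δ).map (Lam Δ) : Set (WW Δ))) (by
    rintro _ ⟨v, -, rfl⟩
    simp [Lam_apply]) hcl
  exact this y.2

theorem YY_nonuniv : ¬ Embeds CantorC (YY Δ) := by
  rintro ⟨U, c, hc, hU⟩
  let T : Dy →ₗ[ℝ] (El Δ → ℝ) :=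
    { toFun := fun f e => (U (toC f)).1 ⟨({0}, fun _ => e), Fam.single _⟩
      map_add' := fun f g => by ext e; simp
      map_smul' := fun r f => by ext e; simp }
  have hTs : ∀ f I F (h : Fam I F), ∑ i ∈ I, T f (F i) = (U (toC f)).1 ⟨(I, F), h⟩ := fun f I F h =>
    (YY_apply (U (toC f)) ⟨(I, F), h⟩).symm
  obtain ⟨M, hM0, hM⟩ : ∃ M : ℝ, 0 ≤ M ∧ ∀ x, ‖U x‖ ≤ M * ‖x‖ := by
    obtain ⟨M, hM0, hM⟩ := U.isBoundedLinearMap.bound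
    exact ⟨M, hM0.le, hM⟩
  have hG : Good T M := by
    refine ⟨fun f r hf I F hF => ?_, fun f ε hε => ?_⟩
    · rw [hTs f I F hF]
      refine (lp.norm_apply_le_norm (by simp) (U (toC f)).1 _).trans ?_
      refine (hM _).trans ?_
      gcongr
      exact norm_toC_le hf
    · have hmem : (U (toC f)).1 ∈ closure ((Adm Δ).map (Lam Δ) : Set (WW Δ)) := (U (toC f)).2
      obtain ⟨_, ⟨v, hv, rfl⟩, hd⟩ := Metric.mem_closure_iff.1 hmem ε hε
      refine ⟨v, hv, fun I F hF => ?_⟩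
      rw [Finset.sum_sub_distrib, hTs f I F hF]
      rw [dist_eq_norm] at hd
      exact (lp.norm_apply_le_norm (by simp) ((U (toC f)).1 - Lam Δ v) ⟨(I, F), hF⟩).trans hd.le
  have hlow : ∀ f z, f.1 z ≠ 0 → ∃ I F, Fam I F ∧ c / 2 * |f.1 z| ≤ |∑ i ∈ I, T f (F i)| := by
    intro f z hz
    by_contra hcon
    push Not at hcon
    have h1 : ‖(U (toC f)).1‖ ≤ c / 2 * |f.1 z| := by
      refine lp.norm_le_of_forall_le (by positivity) fun p => ?_
      have := (hcon p.1.1 p.1.2 p.2).le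
      rw [hTs f _ _ p.2] at this
      exact this
    have h2 : c * ‖toC f‖ ≤ ‖(U (toC f)).1‖ := hU (toC f)
    have h3 : |f.1 z| ≤ ‖toC f‖ := Bd_toC f z
    have h4 : 0 < |f.1 z| := abs_pos.2 hz
    nlinarith
  refine step_e hG (c / 2) (by positivity) fun f z => ?_
  by_cases hz : f.1 z = 0
  · refine ⟨∅, ?_⟩
    obtain ⟨I, F, -, -⟩ := hlow ⟨fun _ => 1, 0, fun _ _ _ => rfl⟩ z one_ne_zero
    exact ⟨F, by intro i hi; simp at hi, by simp [hz]⟩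
  · exact hlow f z hz

end
end NUB


namespace NUB
noncomputable section

variable {Δ : Dat}

def trunc (m : ℕ) (z : CantorSet) : CantorSet := fun i => if i < m then z i else false

lemma trunc_cont (m : ℕ) : Continuous (trunc m) := by
  refine continuous_pi fun i => ?_
  unfold trunc
  split_ifs
  · exact continuous_apply i
  · exact continuous_const

def Pr (m : ℕ) : CantorC →ₗ[ℝ] CantorC where
  toFun f := f.comp ⟨trunc m, trunc_cont m⟩
  map_add' _ _ := rfl
  map_smul' _ _ := rfl

lemma Pr_apply (m : ℕ) (f : CantorC) (z) : Pr m f z = f (trunc m z) := rfl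

lemma norm_Pr (m : ℕ) (f : CantorC) : ‖Pr m f‖ ≤ ‖f‖ :=
  ((Pr m f).norm_le (norm_nonneg _)).2 fun z => f.norm_coe_le_norm _

lemma lev_Pr (m : ℕ) (f : CantorC) : IsLev m (Pr m f) := by
  intro x y h
  rw [Pr_apply, Pr_apply]
  congr 1
  funext i
  unfold trunc
  split_ifs with hi
  · exact h i hi
  · rfl

lemma Pr_eq {m : ℕ} {f : CantorC} (h : IsLev m f) : Pr m f = f := by
  ext z
  rw [Pr_apply]
  exact h _ _ fun i hi => by simp [trunc, hi]

def pk (β : ℕ → Δ.A) (k : ℕ) : CantorC →ₗ[ℝ] CantorC := Pr (Δ.ms (res β k))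

def vv (β : ℕ → Δ.A) : ℕ → CantorC →ₗ[ℝ] Δ.VV
  | 0 => (Finsupp.lsingle (([] : List Δ.A), 0)).comp (pk β 0)
  | n+1 => vv β n + (Finsupp.lsingle (res β (n+1), n+1)).comp (pk β (n+1)) -
      (Finsupp.lsingle (res β (n+1), n)).comp (pk β n)

lemma single_adm {q : List Δ.A × ℕ} {z : CantorC} (h1 : IsLev (Δ.ms q.1) z)
    (h2 : q.2 = q.1.length ∨ q.2 + 1 = q.1.length) : Finsupp.single q z ∈ Adm Δ := by
  intro q'
  by_cases h : q = q'
  · subst h; rw [Finsupp.single_eq_same]; exact ⟨h1, fun _ => h2⟩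
  · rw [Finsupp.single_eq_of_ne (Ne.symm h)]
    exact ⟨fun _ _ _ => rfl, fun h => absurd rfl h⟩

lemma res_len (β : ℕ → Δ.A) (n) : (res β n).length = n := PiNat.res_length β n

lemma vv_adm (β : ℕ → Δ.A) (n : ℕ) (x : CantorC) : vv β n x ∈ Adm Δ := by
  induction n with
  | zero => exact single_adm (lev_Pr _ x) (Or.inl rfl)
  | succ n ih =>
    refine (Adm Δ).sub_mem ((Adm Δ).add_mem ih (single_adm (lev_Pr _ x) (Or.inl ?_)))
      (single_adm ((lev_Pr _ x).mono (ms_succ β n)) (Or.inr ?_))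
    · exact (res_len _ _).symm
    · exact (res_len _ _).symm

lemma InT_res {e : El Δ} {β : ℕ → Δ.A} {n : ℕ} :
    InT e (res β n) ↔ (∀ i < n, β i = e.β i) ∧ e.a ≤ n := by
  rw [InT, res_len, res_eq]

open Classical in
lemma ev_vv_succ (e : El Δ) (β : ℕ → Δ.A) (n : ℕ) (x : CantorC) :
    ev e (vv β (n+1) x) = ev e (vv β n x) + if (∀ i < n+1, β i = e.β i) ∧ e.a ≤ n+1 then
      e.ψ (n+1) (pk β (n+1) x) - e.ψ n (pk β n x) else 0 := by
  have : vv β (n+1) x = vv β n x + Finsupp.single (res β (n+1), n+1) (pk β (n+1) x) -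
      Finsupp.single (res β (n+1), n) (pk β n x) := rfl
  rw [this, map_sub, map_add, ev_single, ev_single]
  simp only [InT_res]
  split_ifs <;> ring

open Classical in
lemma ev_vv (e : El Δ) (β : ℕ → Δ.A) (n : ℕ) (x : CantorC) :
    (¬ ((∀ i < e.a, β i = e.β i) ∧ e.a ≤ n) → ev e (vv β n x) = 0) ∧
    ((∀ i < e.a, β i = e.β i) ∧ e.a ≤ n → ∃ m, ((∀ i < n, β i = e.β i) → m = n) ∧
      ev e (vv β n x) = e.ψ m (pk β m x) - if e.a = 0 then 0 else e.ψ (e.a-1) (pk β (e.a-1) x)) := by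
  induction n with
  | zero =>
    have h0 : vv β 0 x = Finsupp.single (res β 0, 0) (pk β 0 x) := rfl
    rw [h0, ev_single]
    simp only [InT_res]
    constructor
    · intro h
      rw [if_neg]
      intro h'
      exact h ⟨fun i hi => by omega, h'.2⟩
    · rintro ⟨h1, h2⟩
      refine ⟨0, fun _ => rfl, ?_⟩
      rw [if_pos ⟨fun i hi => by omega, h2⟩, if_pos (by omega), sub_zero]
  | succ n ih =>
    rw [ev_vv_succ]
    constructor
    · intro h
      rw [ih.1 (fun h' => h ⟨h'.1, by omega⟩), if_neg, zero_add]
      exact fun h' => h ⟨fun i hi => h'.1 i (by omega), h'.2⟩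
    · rintro ⟨h1, h2⟩
      by_cases han : e.a ≤ n
      · obtain ⟨m, hm, hev⟩ := ih.2 ⟨h1, han⟩
        by_cases hag : ∀ i < n+1, β i = e.β i
        · refine ⟨n+1, fun _ => rfl, ?_⟩
          rw [if_pos ⟨hag, h2⟩, hev, hm fun i hi => hag i (by omega)]
          ring
        · refine ⟨m, fun h => absurd h hag, ?_⟩
          rw [if_neg fun h => hag h.1, hev, add_zero]
      · have ha : e.a = n + 1 := by omega
        refine ⟨n+1, fun _ => rfl, ?_⟩
        rw [ih.1 fun h => han h.2, if_pos ⟨fun i hi => h1 i (by omega), h2⟩, if_neg (by omega), ha]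
        simp

lemma abs_ev_vv (e : El Δ) (β : ℕ → Δ.A) (n : ℕ) (x : CantorC) : |ev e (vv β n x)| ≤ 2 * ‖x‖ := by
  by_cases h : (∀ i < e.a, β i = e.β i) ∧ e.a ≤ n
  · obtain ⟨m, -, hev⟩ := (ev_vv e β n x).2 h
    have hb : ∀ m, |e.ψ m (pk β m x)| ≤ ‖x‖ := fun m => (e.hψ _ _).trans (norm_Pr _ _)
    rw [hev]
    have h1 := abs_le.1 (hb m)
    have h2 := abs_le.1 (hb (e.a - 1))
    rw [abs_le]
    split_ifs
    · constructor <;> linarith [h1.1, h1.2, norm_nonneg x]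
    · constructor <;> linarith [h1.1, h1.2, h2.1, h2.2]
  · rw [(ev_vv e β n x).1 h]; simp

lemma norm_Lam_vv (β : ℕ → Δ.A) (n : ℕ) (x : CantorC) : ‖Lam Δ (vv β n x)‖ ≤ 2 * ‖x‖ := by
  refine norm_Lam_le (by positivity) fun I F hF => amo_sum (by positivity)
    (fun i _ => abs_ev_vv _ _ _ _) fun i hi j hj h1 h2 => ?_
  by_contra hij
  obtain ⟨p, hp1, hp2, hp⟩ := hF i hi j hj hij
  have h1' : ((∀ k < (F i).a, β k = (F i).β k) ∧ (F i).a ≤ n) := by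
    by_contra h; exact h1 ((ev_vv _ β n x).1 h)
  have h2' : ((∀ k < (F j).a, β k = (F j).β k) ∧ (F j).a ≤ n) := by
    by_contra h; exact h2 ((ev_vv _ β n x).1 h)
  exact hp ((h1'.1 p hp1).symm.trans (h2'.1 p hp2))

def En (β : ℕ → Δ.A) (n : ℕ) : Submodule ℝ CantorC :=
  Submodule.span ℝ ((fun i => Δ.D (β i)) '' Set.Iio n)

lemma En_mono (β : ℕ → Δ.A) : Monotone (En β) := fun _ _ h =>
  Submodule.span_mono (Set.image_mono (Set.Iio_subset_Iio h))

lemma lev_En {β : ℕ → Δ.A} {n : ℕ} {x : CantorC} (hx : x ∈ En β n) : IsLev (Δ.ms (res β n)) x := by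
  induction hx using Submodule.span_induction with
  | mem x hx =>
    obtain ⟨i, hi, rfl⟩ := hx
    exact (Δ.hlv _).mono (lv_le_ms β hi)
  | zero => exact fun _ _ _ => rfl
  | add x y _ _ h1 h2 => intro u v h; simp [h1 u v h, h2 u v h]
  | smul r x _ h1 => intro u v h; simp [h1 u v h]

lemma pk_En {β : ℕ → Δ.A} {n : ℕ} {x : CantorC} (hx : x ∈ En β n) : pk β n x = x := Pr_eq (lev_En hx)

lemma Lam_vv_succ {β : ℕ → Δ.A} {n : ℕ} {x : CantorC} (hx : x ∈ En β n) :
    Lam Δ (vv β (n+1) x) = Lam Δ (vv β n x) := by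
  classical
  ext p
  rw [Lam_apply, Lam_apply]
  refine Finset.sum_congr rfl fun i _ => ?_
  rw [ev_vv_succ]
  split_ifs with h
  · have hx' := En_mono β (Nat.le_succ n) hx
    rw [pk_En hx, pk_En hx']
    have hE : En β (n+1) = En (p.1.2 i).β (n+1) := by
      unfold En; congr 1
      refine Set.image_congr fun k hk => ?_
      rw [h.1 k hk]
    have hE' : En β n = En (p.1.2 i).β n := by
      unfold En; congr 1
      refine Set.image_congr fun k hk => ?_
      rw [h.1 k (Nat.lt_succ_of_lt hk)]
    rw [hE] at hx'
    rw [hE'] at hx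
    rw [comp_span _ _ hx, comp_span _ _ hx']; ring
  · ring

lemma Lam_vv_le {β : ℕ → Δ.A} {n k : ℕ} (hk : n ≤ k) {x : CantorC} (hx : x ∈ En β n) :
    Lam Δ (vv β k x) = Lam Δ (vv β n x) := by
  induction k, hk using Nat.le_induction with
  | base => rfl
  | succ k hk ih => rw [Lam_vv_succ (En_mono β hk hx), ih]

lemma exists_En {β : ℕ → Δ.A} {x : CantorC}
    (hx : x ∈ Submodule.span ℝ (Set.range fun i => Δ.D (β i))) : ∃ n, x ∈ En β n := by
  have : x ∈ ⨆ n, En β n := by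
    refine (Submodule.span_le.2 ?_ : _ ≤ ⨆ n, En β n) hx
    rintro _ ⟨i, rfl⟩
    exact (le_iSup (En β) (i+1)) (Submodule.subset_span ⟨i, Nat.lt_succ_self i, rfl⟩)
  exact (Submodule.mem_iSup_of_directed _ (En_mono β).directed_le).1 this

theorem Xβ_embeds {β : ℕ → Δ.A} (hβ : β ∈ Δ.B) :
    Embeds (Submodule.span ℝ (Set.range fun i => Δ.D (β i))).topologicalClosure (YY Δ) := by
  set X := Submodule.span ℝ (Set.range fun i => Δ.D (β i)) with hX
  choose N hN using fun x : X => exists_En x.2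
  have hmem : ∀ v ∈ Adm Δ, Lam Δ v ∈ YY Δ := fun v hv =>
    Submodule.le_topologicalClosure _ ⟨v, hv, rfl⟩
  let s : X → WW Δ := fun x => Lam Δ (vv β (N x) x.1)
  have hs : ∀ (x : X) k, N x ≤ k → Lam Δ (vv β k x.1) = s x := fun x k hk => Lam_vv_le hk (hN x)
  let S : X →ₗ[ℝ] YY Δ :=
    { toFun := fun x => ⟨s x, hmem _ (vv_adm _ _ _)⟩
      map_add' := fun x y => by
        apply Subtype.ext
        let k := N x + N y + N (x + y)
        change s (x + y) = s x + s y
        rw [← hs x k (by omega), ← hs y k (by omega), ← hs (x+y) k (by omega)]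
        simp
      map_smul' := fun r x => by
        apply Subtype.ext
        let k := N x + N (r • x)
        change s (r • x) = r • s x
        rw [← hs x k (by omega), ← hs (r • x) k (by omega)]
        simp }
  refine embed_closure X S 2 1 one_pos (fun x => norm_Lam_vv _ _ _) fun x => ?_
  obtain ⟨φ, hφ, hφx⟩ := norming x.1
  let e := constEl β hβ 0 φ hφ
  obtain ⟨m, hm, hev⟩ := (ev_vv e β (N x) x.1).2 ⟨fun i hi => rfl, Nat.zero_le _⟩
  rw [hm fun i _ => rfl, pk_En (hN x), if_pos (show e.a = 0 from rfl), sub_zero] at hev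
  change ev e (vv β (N x) x.1) = φ x.1 at hev
  have h1 := lp.norm_apply_le_norm (by simp) (s x) ⟨({0}, fun _ => e), Fam.single _⟩
  have h2 : s x ⟨({0}, fun _ => e), Fam.single _⟩ = ev e (vv β (N x) x.1) := by
    simp [s, Lam_apply]
  rw [h2, hev, hφx, norm_norm] at h1
  rw [one_mul]; exact h1

theorem partII (Δ : Dat) : ∃ Y : SB, Y ∈ NU ∧ ∀ β ∈ Δ.B,
    Embeds (Submodule.span ℝ (Set.range fun i => Δ.D (β i))).topologicalClosure Y.1 := by
  have : TopologicalSpace.SeparableSpace (YY Δ) := YY_sep.separableSpace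
  obtain ⟨Y, h1, h2⟩ := toSB (YY Δ)
  exact ⟨Y, fun h => YY_nonuniv (Embeds.comp h h2), fun β hβ => Embeds.comp (Xβ_embeds hβ) h1⟩

end
end NUB


namespace NUB
noncomputable section

lemma embed_of_two {V E Y : Type*} [AddCommGroup V] [Module ℝ V] [NormedAddCommGroup E]
    [NormedSpace ℝ E] [NormedAddCommGroup Y] [NormedSpace ℝ Y] [CompleteSpace Y]
    (L1 : V →ₗ[ℝ] E) (L2 : V →ₗ[ℝ] Y) (K : ℝ) (h1 : ∀ v, ‖L1 v‖ ≤ K * ‖L2 v‖)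
    (h2 : ∀ v, ‖L2 v‖ ≤ K * ‖L1 v‖) : Embeds (LinearMap.range L1).topologicalClosure Y := by
  choose s hs using fun y : LinearMap.range L1 => y.2
  have hz : ∀ v, L1 v = 0 → L2 v = 0 := fun v hv => by
    have := h2 v
    rw [hv, norm_zero, mul_zero] at this
    exact norm_le_zero_iff.1 this
  let S : LinearMap.range L1 →ₗ[ℝ] Y :=
    { toFun := fun y => L2 (s y)
      map_add' := fun y z => by
        have := hz (s (y + z) - (s y + s z)) (by simp [hs])
        rw [map_sub, sub_eq_zero] at this
        rw [this, map_add]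
      map_smul' := fun r y => by
        have := hz (s (r • y) - (r • s y)) (by simp [hs])
        rw [map_sub, sub_eq_zero] at this
        rw [this, map_smul]; rfl }
  have hK : 0 < |K| + 1 := by positivity
  refine embed_closure _ S K (|K| + 1)⁻¹ (by positivity) (fun y => ?_) (fun y => ?_)
  · have := h2 (s y); rw [hs y] at this; exact this
  · have := h1 (s y); rw [hs y] at this
    rw [inv_mul_le_iff₀ hK]
    refine this.trans ?_
    change _ ≤ _ * ‖L2 (s y)‖
    gcongr
    linarith [le_abs_self K]

/-- biorthogonal systems -/
theorem biorth (E : Type*) [NormedAddCommGroup E] [NormedSpace ℝ E] (v : ℕ → E) :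
    ∃ (x : ℕ → E) (f : ℕ → E →ₗ[ℝ] ℝ) (C : ℕ → ℝ), (∀ j, 0 ≤ C j) ∧
      (∀ j y, |f j y| ≤ C j * ‖y‖) ∧ (∀ j, v j ∈ Submodule.span ℝ (Set.range x)) ∧
      (∀ j k, j ≠ k → f j (x k) = 0) ∧ ∀ j, x j = 0 ∨ f j (x j) = 1 := by
  have hg : ∀ x : E, ∃ g : E →L[ℝ] ℝ, (x = 0 → g = 0) ∧ (x ≠ 0 → g x = 1) := by
    intro x
    by_cases hx : x = 0
    · exact ⟨0, fun _ => rfl, fun h => absurd hx h⟩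
    · obtain ⟨g, -, hgx⟩ := exists_dual_vector ℝ x (norm_ne_zero_iff.2 hx)
      refine ⟨‖x‖⁻¹ • g, fun h => absurd h hx, fun _ => ?_⟩
      have : ‖x‖ ≠ 0 := norm_ne_zero_iff.2 hx
      simp [hgx, this]
  choose g hg0 hg1 using hg
  let R : ℕ → (E →L[ℝ] E) := fun n => Nat.rec (ContinuousLinearMap.id ℝ E)
    (fun j R => R - ((g (R (v j))).comp R).smulRight (R (v j))) n
  let x : ℕ → E := fun j => R j (v j)
  let f : ℕ → (E →L[ℝ] ℝ) := fun j => (g (x j)).comp (R j)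
  have hR : ∀ j y, R (j+1) y = R j y - f j y • x j := fun j y => rfl
  have hf : ∀ j y, f j y = g (x j) (R j y) := fun j y => rfl
  have hi : ∀ j y, y - R j y ∈ Submodule.span ℝ (x '' Set.Iio j) := by
    intro j
    induction j with
    | zero => intro y; simp [R]
    | succ j ih =>
      intro y
      rw [hR, ← sub_add]
      refine add_mem (Submodule.span_mono (Set.image_mono (Set.Iio_subset_Iio (Nat.le_succ j))) (ih y)) ?_
      exact Submodule.smul_mem _ _ (Submodule.subset_span ⟨j, Nat.lt_succ_self j, rfl⟩)
  have hidem : ∀ j, (∀ k < j, R j (x k) = 0) → ∀ y, R j (R j y) = R j y := by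
    intro j hj y
    have : Submodule.span ℝ (x '' Set.Iio j) ≤ LinearMap.ker (R j).toLinearMap := by
      rw [Submodule.span_le]
      rintro _ ⟨k, hk, rfl⟩
      exact hj k hk
    have h2 := this (hi j y)
    have h3 : R j (y - R j y) = 0 := h2
    rw [map_sub, sub_eq_zero] at h3
    exact h3.symm
  have hfx' : ∀ j, R j (x j) = x j → x j = 0 ∨ f j (x j) = 1 := by
    intro j hj
    by_cases h : x j = 0
    · exact Or.inl h
    · right; rw [hf, hj]; exact hg1 _ h
  have hii : ∀ j, ∀ k < j, R j (x k) = 0 := by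
    intro j
    induction j with
    | zero => intro k hk; omega
    | succ j ih =>
      intro k hk
      rw [hR]
      rcases Nat.lt_succ_iff_lt_or_eq.1 hk with h | h
      · rw [hf, ih k h]; simp
      · subst h
        have h1 := hidem k ih (v k)
        change R k (x k) = x k at h1
        rw [h1]
        rcases hfx' k h1 with h | h
        · simp [h]
        · rw [h]; simp
  have hRx : ∀ j, R j (x j) = x j := fun j => hidem j (hii j) (v j)
  have hfR : ∀ j k, j < k → ∀ y, f j (R k y) = 0 := by
    intro j k hjk
    induction k, hjk using Nat.le_induction with
    | base =>
      intro y
      rw [hR, map_sub, map_smul, hf j (R j y), hidem j (hii j), ← hf]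
      rcases hfx' j (hRx j) with h | h
      · simp [hf, hg0 _ h]
      · rw [h]; simp
    | succ k hk ih =>
      intro y
      rw [hR, map_sub, map_smul, ih]
      have : f j (x k) = 0 := ih (v k)
      rw [this]; simp
  refine ⟨x, fun j => (f j).toLinearMap, fun j => ‖f j‖, fun j => norm_nonneg _,
    fun j y => (f j).le_opNorm y, fun j => ?_, fun j k hjk => ?_, fun j => hfx' j (hRx j)⟩
  · have h1 := Submodule.span_mono (Set.image_subset_range _ _) (hi j (v j))
    have h2 : x j ∈ Submodule.span ℝ (Set.range x) := Submodule.subset_span ⟨j, rfl⟩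
    have := add_mem h1 h2
    simpa [x] using this
  · rcases lt_or_gt_of_ne hjk with h | h
    · exact hfR j k h (v k)
    · change f j (x k) = 0
      rw [hf, hii j k h, map_zero]

abbrev lc {E : Type*} [AddCommGroup E] [Module ℝ E] (x : ℕ → E) : (ℕ →₀ ℝ) →ₗ[ℝ] E :=
  Finsupp.linearCombination ℝ x

/-- rational form of equivalence of sequences -/
def EqQ (x y : ℕ → CantorC) (K : ℕ) : Prop := ∀ (n : ℕ) (a : Fin n → ℚ),
  ‖∑ i, (a i : ℝ) • x i‖ ≤ K * ‖∑ i, (a i : ℝ) • y i‖ ∧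
  ‖∑ i, (a i : ℝ) • y i‖ ≤ K * ‖∑ i, (a i : ℝ) • x i‖

lemma EqQ.real {x y : ℕ → CantorC} {K : ℕ} (h : EqQ x y K) (c : ℕ →₀ ℝ) :
    ‖lc x c‖ ≤ K * ‖lc y c‖ ∧ ‖lc y c‖ ≤ K * ‖lc x c‖ := by
  obtain ⟨n, hn⟩ : ∃ n, c.support ⊆ Finset.range n := by
    refine ⟨c.support.sup id + 1, fun i hi => ?_⟩
    rw [Finset.mem_range, Nat.lt_succ_iff]
    exact Finset.le_sup (f := id) hi
  have hsum : ∀ x : ℕ → CantorC, lc x c = ∑ i : Fin n, c i • x i := by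
    intro x
    rw [lc, Finsupp.linearCombination_apply, Finsupp.sum_of_support_subset _ hn _ (by simp),
      Finset.sum_range]
  rw [hsum, hsum]
  have hd : DenseRange fun (a : Fin n → ℚ) (i : Fin n) => (a i : ℝ) :=
    DenseRange.piMap fun _ => Rat.isDenseEmbedding_coe_real.dense
  have := hd.induction (P := fun b : Fin n → ℝ => ‖∑ i, b i • x i‖ ≤ K * ‖∑ i, b i • y i‖ ∧
    ‖∑ i, b i • y i‖ ≤ K * ‖∑ i, b i • x i‖) (by rintro _ ⟨a, rfl⟩; exact h n a) ?_ fun i => c i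
  · exact this
  · have hcx : ∀ x : ℕ → CantorC, Continuous fun b : Fin n → ℝ => ‖∑ i, b i • x i‖ := fun x =>
      continuous_norm.comp (continuous_finsetSum _ fun i _ =>
        (continuous_apply i).smul continuous_const)
    exact (isClosed_le (hcx x) (continuous_const.mul (hcx y))).inter
      (isClosed_le (hcx y) (continuous_const.mul (hcx x)))

lemma EqQ.of_real {x y : ℕ → CantorC} {K : ℕ} (h : ∀ c : ℕ →₀ ℝ,
    ‖lc x c‖ ≤ K * ‖lc y c‖ ∧ ‖lc y c‖ ≤ K * ‖lc x c‖) : EqQ x y K := by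
  intro n a
  have := h (∑ i : Fin n, Finsupp.single (i : ℕ) (a i : ℝ))
  simpa [map_sum, Finsupp.linearCombination_single] using this

lemma EqQ.symm {x y : ℕ → CantorC} {K : ℕ} (h : EqQ x y K) : EqQ y x K := fun n a => (h n a).symm

lemma EqQ.embeds {x y : ℕ → CantorC} {K : ℕ} (h : EqQ x y K) (Y : Submodule ℝ CantorC)
    (hY : IsClosed (Y : Set CantorC)) (hy : ∀ i, y i ∈ Y) :
    Embeds (Submodule.span ℝ (Set.range x)).topologicalClosure Y := by
  have : CompleteSpace Y := hY.completeSpace_coe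
  rw [← Finsupp.range_linearCombination]
  have hval : ∀ c, ((lc (fun i => (⟨y i, hy i⟩ : Y)) c : Y) : CantorC) = lc y c := by
    intro c
    rw [lc, lc, Finsupp.linearCombination_apply, Finsupp.linearCombination_apply, Finsupp.sum,
      Finsupp.sum]
    simp
  refine embed_of_two (lc x) (lc fun i => (⟨y i, hy i⟩ : Y)) K (fun c => ?_) (fun c => ?_)
  · have := (h.real c).1; rw [← hval] at this; exact this
  · have := (h.real c).2; rw [← hval] at this; exact this

/-- every closed subspace has a dense sequence equivalent to a sequence of letters -/
theorem exists_code (D : ℕ → CantorC) (hD : DenseRange D) (hD0 : D 0 = 0) (X : Submodule ℝ CantorC)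
    (hX : IsClosed (X : Set CantorC)) : ∃ (x : ℕ → CantorC) (d : ℕ → ℕ), (∀ i, x i ∈ X) ∧
      (Submodule.span ℝ (Set.range x)).topologicalClosure = X ∧ EqQ (fun i => D (d i)) x 2 := by
  have : TopologicalSpace.SeparableSpace X := inferInstance
  obtain ⟨x, f, C, hC0, hC, hv, hf1, hf2⟩ := biorth X (TopologicalSpace.denseSeq X)
  have hd : ∀ j, ∃ n, (x j = 0 → D n = 0) ∧ C j * ‖D n - x j‖ ≤ (1/2) ^ (j+2) := by
    intro j
    by_cases hx : x j = 0
    · refine ⟨0, fun _ => hD0, ?_⟩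
      rw [hD0, hx]; simp
    · have hpos : (0:ℝ) < (1/2) ^ (j+2) / (C j + 1) := by have := hC0 j; positivity
      obtain ⟨n, hn⟩ := hD.exists_dist_lt (x j : CantorC) hpos
      refine ⟨n, fun h => absurd h hx, ?_⟩
      rw [dist_comm, dist_eq_norm] at hn
      have := hC0 j
      rw [lt_div_iff₀ (by positivity)] at hn
      nlinarith [norm_nonneg (D n - x j), hC0 j]
  choose d hd0 hd using hd
  refine ⟨fun i => x i, d, fun i => (x i).2, ?_, EqQ.of_real fun c => ?_⟩
  · apply le_antisymm
    · refine Submodule.topologicalClosure_minimal _ ?_ hX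
      rw [Submodule.span_le]
      rintro _ ⟨i, rfl⟩
      exact (x i).2
    · intro z hz
      have hz' : (⟨z, hz⟩ : X) ∈ closure (Set.range (TopologicalSpace.denseSeq X)) :=
        TopologicalSpace.denseRange_denseSeq X _
      have := image_closure_subset_closure_image continuous_subtype_val ⟨_, hz', rfl⟩
      refine closure_mono ?_ this
      rintro _ ⟨_, ⟨j, rfl⟩, rfl⟩
      have h1 : (TopologicalSpace.denseSeq X j : CantorC) ∈
          (Submodule.span ℝ (Set.range x)).map X.subtype := ⟨_, hv j, rfl⟩
      rw [Submodule.map_span, ← Set.range_comp] at h1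
      exact h1
  · set z : X := lc x c with hz
    have hzv : lc (fun i => (x i : CantorC)) c = z := by
      rw [hz, lc, lc, Finsupp.linearCombination_apply, Finsupp.linearCombination_apply, Finsupp.sum,
        Finsupp.sum]
      simp
    have hcoef : ∀ i, f i z = c i * f i (x i) := by
      intro i
      rw [hz, lc, Finsupp.linearCombination_apply, Finsupp.sum, map_sum]
      simp only [map_smul, smul_eq_mul]
      by_cases hi : i ∈ c.support
      · rw [Finset.sum_eq_single_of_mem i hi]
        intro k _ hk
        rw [hf1 i k hk.symm, mul_zero]
      · rw [Finset.sum_eq_zero, Finsupp.notMem_support_iff.1 hi, zero_mul]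
        intro k hk
        rw [hf1 i k (fun h => hi (h ▸ hk)), mul_zero]
    have hterm : ∀ i, ‖c i • (D (d i) - x i)‖ ≤ (1/2)^(i+2) * ‖z‖ := by
      intro i
      rcases hf2 i with h | h
      · rw [hd0 i h, h]; simp
      · have h1 := hcoef i
        rw [h, mul_one] at h1
        rw [norm_smul, ← h1]
        calc ‖f i z‖ * ‖D (d i) - x i‖ ≤ C i * ‖z‖ * ‖D (d i) - x i‖ := by
              gcongr; exact hC i z
          _ = C i * ‖D (d i) - x i‖ * ‖z‖ := by ring
          _ ≤ _ := by gcongr; exact hd i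
    have hdiff : ‖lc (fun i => D (d i)) c - lc (fun i => (x i : CantorC)) c‖ ≤ 1/2 * ‖z‖ := by
      rw [lc, lc, Finsupp.linearCombination_apply, Finsupp.linearCombination_apply, Finsupp.sum,
        Finsupp.sum, ← Finset.sum_sub_distrib]
      simp only [← smul_sub]
      refine (norm_sum_le _ _).trans ((Finset.sum_le_sum fun i _ => hterm i).trans ?_)
      rw [← Finset.sum_mul]
      gcongr
      have hs : HasSum (fun i : ℕ => ((1:ℝ)/2)^(i+2)) (1/2) := by
        have := hasSum_geometric_two.mul_right ((1/2:ℝ)^2)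
        simp only [← pow_add] at this
        rw [show (2 * (1/2)^2 : ℝ) = 1/2 by norm_num] at this
        exact this
      exact sum_le_hasSum _ (fun i _ => by positivity) hs
    rw [hzv] at hdiff ⊢
    have hnz : ‖(z : CantorC)‖ = ‖z‖ := rfl
    have h1 := norm_sub_norm_le (lc (fun i => D (d i)) c) (z : CantorC)
    have h2 := norm_sub_norm_le (z : CantorC) (lc (fun i => D (d i)) c)
    rw [norm_sub_rev] at h2
    rw [hnz] at *
    push_cast
    constructor <;> linarith [norm_nonneg z]

end
end NUB


namespace NUB
noncomputable section

lemma exists_letters : ∃ (D : ℕ → CantorC) (lv : ℕ → ℕ), DenseRange D ∧ D 0 = 0 ∧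
    ∀ n, IsLev (lv n) (D n) := by
  have hd : Dense (Set.range toC) := toC_dense
  obtain ⟨t, ht, htc, htd⟩ := hd.exists_countable_dense_subset
  obtain ⟨u, hu⟩ := htc.exists_eq_range htd.nonempty
  have hlev : ∀ n, ∃ m, IsLev m (u n) := by
    intro n
    obtain ⟨f, hf⟩ := ht (hu ▸ Set.mem_range_self n : u n ∈ t)
    rw [← hf]
    exact f.2
  choose l hl using hlev
  refine ⟨fun n => Nat.casesOn n 0 u, fun n => Nat.casesOn n 0 l, ?_, rfl, ?_⟩
  · refine Dense.mono ?_ htd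
    rw [hu]
    rintro _ ⟨n, rfl⟩
    exact ⟨n+1, rfl⟩
  · intro n
    cases n with
    | zero => exact fun _ _ _ => rfl
    | succ n => exact hl n

instance : PolishSpace CantorC := inferInstance

set_option synthInstance.maxHeartbeats 200000 in
set_option synthInstance.maxSize 1000 in
theorem code_analytic (D : ℕ → CantorC) (g : (ℕ → ℕ) → SB) (hg : Measurable g) :
    AnalyticSet {d : ℕ → ℕ | ∃ (τ : ℕ → ℕ) (x : ℕ → CantorC) (K : ℕ), (∀ i, x i ∈ (g τ).1) ∧
      EqQ (fun i => D (d i)) x K} := by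
  let : MeasurableSpace CantorC := borel CantorC
  have : BorelSpace CantorC := ⟨rfl⟩
  let P := ((ℕ → ℕ) × (ℕ → CantorC)) × (ℕ × (ℕ → ℕ))
  let Z : Set P := {p | (∀ i, p.1.2 i ∈ (g p.1.1).1) ∧ EqQ (fun i => D (p.2.2 i)) p.1.2 p.2.1}
  have hZ : MeasurableSet Z := by
    refine MeasurableSet.inter (s₁ := {p : P | ∀ i, p.1.2 i ∈ (g p.1.1).1})
      (s₂ := {p : P | EqQ (fun i => D (p.2.2 i)) p.1.2 p.2.1}) ?_ ?_
    · obtain ⟨b, hbc, -, hb⟩ := TopologicalSpace.exists_countable_basis CantorC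
      have : {p : P | ∀ i, p.1.2 i ∈ (g p.1.1).1} = ⋂ i : ℕ, ⋂ U ∈ b,
          ({p : P | p.1.2 i ∈ U}ᶜ ∪ {p : P | (((g p.1.1).1 : Set CantorC) ∩ U).Nonempty}) := by
        ext p
        simp only [Set.mem_ofPred_eq, Set.mem_iInter, Set.mem_union, Set.mem_compl_iff]
        refine forall_congr' fun i => ?_
        constructor
        · intro h U _
          by_cases hU : p.1.2 i ∈ U
          · exact Or.inr ⟨_, h, hU⟩
          · exact Or.inl hU
        · intro h
          have hcl := (g p.1.1).2
          have : p.1.2 i ∈ closure ((g p.1.1).1 : Set CantorC) := by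
            rw [hb.mem_closure_iff]
            intro U hU hx
            rcases h U hU with h | h
            · exact absurd hx h
            · rwa [Set.inter_comm]
          rw [hcl.closure_eq] at this
          exact this
      rw [this]
      refine MeasurableSet.iInter fun i => MeasurableSet.biInter hbc fun U hU => ?_
      refine MeasurableSet.union (MeasurableSet.compl ?_) ?_
      · have hm : Measurable fun p : P => p.1.2 i :=
          (measurable_pi_apply i).comp (measurable_snd.comp measurable_fst)
        exact hm (hb.isOpen hU).measurableSet
      · have hm : Measurable fun p : P => g p.1.1 := hg.comp (measurable_fst.comp measurable_fst)
        exact hm (MeasurableSpace.measurableSet_generateFrom ⟨U, hb.isOpen hU, rfl⟩)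
    · have hcl : IsClosed {p : P | EqQ (fun i => D (p.2.2 i)) p.1.2 p.2.1} := by
        simp only [EqQ, Set.ofPred_forall]
        refine isClosed_iInter fun n => isClosed_iInter fun a => ?_
        have h1 : Continuous fun p : P => ‖∑ i : Fin n, (a i : ℝ) • D (p.2.2 i)‖ := by
          refine continuous_norm.comp (continuous_finsetSum _ fun i _ => ?_)
          have : Continuous fun p : P => D (p.2.2 i) :=
            (continuous_of_discreteTopology (f := D)).comp
              ((continuous_apply (i : ℕ)).comp (continuous_snd.comp continuous_snd))
          exact this.const_smul (a i : ℝ)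
        have h2 : Continuous fun p : P => ‖∑ i : Fin n, (a i : ℝ) • p.1.2 i‖ := by
          refine continuous_norm.comp (continuous_finsetSum _ fun i _ => ?_)
          have : Continuous fun p : P => p.1.2 i :=
            (continuous_apply (i : ℕ)).comp (continuous_snd.comp continuous_fst)
          exact this.const_smul (a i : ℝ)
        have h3 : Continuous fun p : P => (p.2.1 : ℝ) :=
          (continuous_of_discreteTopology (f := fun k : ℕ => (k : ℝ))).comp
            (continuous_fst.comp continuous_snd)
        exact (isClosed_le h1 (h3.mul h2)).inter (isClosed_le h2 (h3.mul h1))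
      have : OpensMeasurableSpace P := inferInstanceAs
        (OpensMeasurableSpace (((ℕ → ℕ) × (ℕ → CantorC)) × (ℕ × (ℕ → ℕ))))
      exact hcl.measurableSet
  have := hZ.analyticSet_image (f := fun p : P => p.2.2) (measurable_snd.comp measurable_snd)
  convert this using 1
  ext d
  constructor
  · rintro ⟨τ, x, K, h1, h2⟩
    exact ⟨((τ, x), (K, d)), ⟨h1, h2⟩, rfl⟩
  · rintro ⟨⟨⟨τ, x⟩, ⟨K, d'⟩⟩, ⟨h1, h2⟩, rfl⟩
    exact ⟨τ, x, K, h1, h2⟩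

theorem main (A : Set SB) (hA : IsAnalyticIn A) (hAsub : A ⊆ NU) :
    ∃ Y : SB, Y ∈ NU ∧ ∀ X ∈ A, Embeds ↥X.1 ↥Y.1 := by
  obtain ⟨g, hg, rfl⟩ := hA
  obtain ⟨D, lv, hD, hD0, hlv⟩ := exists_letters
  have hcode : ∀ τ, ∃ (x : ℕ → CantorC) (d : ℕ → ℕ), (∀ i, x i ∈ (g τ).1) ∧
      (Submodule.span ℝ (Set.range x)).topologicalClosure = (g τ).1 ∧
      EqQ (fun i => D (d i)) x 2 := fun τ => exists_code D hD hD0 (g τ).1 (g τ).2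
  have han := code_analytic D g hg
  rw [AnalyticSet] at han
  rcases han with han | ⟨f, hf, hrange⟩
  · obtain ⟨x, d, h1, -, h3⟩ := hcode 0
    have : d ∈ (∅ : Set (ℕ → ℕ)) := by rw [← han]; exact ⟨0, x, 2, h1, h3⟩
    exact absurd this (Set.notMem_empty d)
  have hnon : ∀ d ∈ Set.range f, ¬ Embeds CantorC
      (Submodule.span ℝ (Set.range fun i => D (d i))).topologicalClosure := by
    intro d hd hE
    rw [hrange] at hd
    obtain ⟨τ, x, K, h1, h2⟩ := hd
    exact hAsub (Set.mem_range_self τ) (Embeds.comp hE (h2.embeds (g τ).1 (g τ).2 h1))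
  let B : Set (ℕ → ℕ × ℕ) := {β | (fun i => (β i).1) = f fun i => (β i).2}
  have hB : IsClosed B := isClosed_eq (by fun_prop) (hf.comp (by fun_prop))
  let Δ : Dat :=
    { A := ℕ × ℕ
      cnt := inferInstance
      D := fun a => D a.1
      lv := fun a => lv a.1
      hlv := fun a => hlv a.1
      B := B
      closed := fun γ hγ => by
        choose β hβ hβγ using hγ
        refine hB.mem_of_tendsto (f := β) (b := atTop) ?_ (Eventually.of_forall hβ)
        rw [tendsto_pi_nhds]
        intro i
        refine tendsto_const_nhds.congr' ?_
        filter_upwards [eventually_gt_atTop i] with n hn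
        exact (hβγ n i hn).symm
      nonuniv := fun β hβ => hnon (fun i => (β i).1) ⟨_, (Eq.symm hβ)⟩ }
  obtain ⟨Y, hY, hemb⟩ := partII Δ
  refine ⟨Y, hY, ?_⟩
  rintro _ ⟨τ, rfl⟩
  obtain ⟨x, d, h1, h2, h3⟩ := hcode τ
  have hd : d ∈ Set.range f := by rw [hrange]; exact ⟨τ, x, 2, h1, h3⟩
  obtain ⟨σ, hσ⟩ := hd
  have e1 := hemb (fun i => (d i, σ i)) hσ.symm
  have e2 := h3.symm.embeds (Submodule.span ℝ (Set.range fun i => D (d i))).topologicalClosure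
    (Submodule.isClosed_topologicalClosure _)
    (fun i => Submodule.le_topologicalClosure _ (Submodule.subset_span ⟨i, rfl⟩))
  rw [h2] at e2
  exact Embeds.comp e2 e1

end
end NUB

/-- **Theorem (Dodos).** The class `NU` of non-universal separable Banach spaces is
strongly bounded: for every analytic subset `A` of `NU` there exists a non-universal
separable Banach space `Y ∈ NU` such that every `X ∈ A` embeds isomorphically into `Y`. -/
theorem NU_strongly_bounded (A : Set SB) (hA : IsAnalyticIn A) (hAsub : A ⊆ NU) :
    ∃ Y : SB, Y ∈ NU ∧ ∀ X ∈ A, Embeds ↥X.1 ↥Y.1 :=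
  NUB.main A hA hAsub
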